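/- arXiv:2305.05284 — 5 statements merged into one kernel-verified Lean document; each statement's English description precedes it below -/
import Mathlib

section
/- Let t : Ω → Σ be a Kolmogorov compression model and Q a probability measure on Ω. Define E* : Ω → [0,∞) by E*(ω) = |t^{-1}(t(ω))| · Q({ω}) / Q(t^{-1}(t(ω))) if Q(t^{-1}(t(ω))) > 0, and E*(ω) = 1 otherwise. Then E* is an e-variable with respect to t, and for every e-variable E' with respect to t one has ∑_{ω : Q({ω})>0} Q({ω}) ln E'(ω) ≤ ∑_{ω : Q({ω})>0} Q({ω}) ln E*(ω) (with values in [−∞,∞), the left side being −∞ if E' vanishes on a point of positive Q-probability). -/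
open Finset

/-- A probability measure on a finite type, given by its mass function. -/
def IsProbability {Ω : Type*} [Fintype Ω] (Q : Ω → ℝ) : Prop :=
  (∀ ω, 0 ≤ Q ω) ∧ ∑ ω : Ω, Q ω = 1

/-- An e-variable with respect to a Kolmogorov compression model `t`:
a nonnegative function whose arithmetic mean over each fiber of `t` is at most 1. -/
def IsEVariable {Ω S : Type*} [Fintype Ω] [DecidableEq S] (t : Ω → S)
    (E : Ω → ℝ) : Prop :=
  (∀ ω, 0 ≤ E ω) ∧
    ∀ σ ∈ Set.range t,
      (∑ ω ∈ Finset.univ.filter fun ω => t ω = σ, E ω) /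
        ((Finset.univ.filter fun ω => t ω = σ).card : ℝ) ≤ 1

/-- The e-power of `E` under `Q`, with values in `[−∞, ∞)`:
`∑_{ω : Q({ω}) > 0} Q({ω}) ln E(ω)`, equal to `−∞` when `E` vanishes at a point
of positive `Q`-probability. -/
noncomputable def ePower {Ω : Type*} [Fintype Ω] (Q : Ω → ℝ) (E : Ω → ℝ) : EReal :=
  ∑ ω ∈ Finset.univ.filter fun ω => 0 < Q ω,
    ((Q ω : ℝ) : EReal) * (if E ω = 0 then (⊥ : EReal) else ((Real.log (E ω) : ℝ) : EReal))

/-- The likelihood-ratio e-variable `E*`. -/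
noncomputable def optimalE {Ω S : Type*} [Fintype Ω] [DecidableEq S] (t : Ω → S)
    (Q : Ω → ℝ) (ω : Ω) : ℝ :=
  if 0 < ∑ ω' ∈ Finset.univ.filter fun ω' => t ω' = t ω, Q ω' then
    ((Finset.univ.filter fun ω' => t ω' = t ω).card : ℝ) * Q ω /
      (∑ ω' ∈ Finset.univ.filter fun ω' => t ω' = t ω, Q ω')
  else 1

theorem ereal_coe_sum_aux {ι : Type*} (s : Finset ι) (f : ι → ℝ) :
    ((∑ i ∈ s, f i : ℝ) : EReal) = ∑ i ∈ s, ((f i : ℝ) : EReal) := by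
  classical
  induction s using Finset.induction_on with
  | empty => simp
  | insert a s ha ih => rw [Finset.sum_insert ha, Finset.sum_insert ha, EReal.coe_add, ih]

theorem ePower_real_aux {Ω : Type*} [Fintype Ω] (Q E : Ω → ℝ)
    (h : ∀ ω, 0 < Q ω → E ω ≠ 0) :
    ePower Q E = ((∑ ω ∈ Finset.univ.filter fun ω => 0 < Q ω, Q ω * Real.log (E ω) : ℝ) : EReal) := by
  unfold ePower
  rw [ereal_coe_sum_aux]
  refine Finset.sum_congr rfl fun ω hω => ?_
  rw [if_neg (h ω (Finset.mem_filter.1 hω).2), EReal.coe_mul]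

theorem optimalE_is_optimal {Ω S : Type*} [Fintype Ω] [Nonempty Ω] [DecidableEq S]
    (t : Ω → S) (Q : Ω → ℝ) (hQ : IsProbability Q) :
    IsEVariable t (optimalE t Q) ∧
      ∀ E' : Ω → ℝ, IsEVariable t E' → ePower Q E' ≤ ePower Q (optimalE t Q) := by
  classical
  obtain ⟨hQ0, hQ1⟩ := hQ
  set q : S → ℝ := fun σ => ∑ ω ∈ Finset.univ.filter (fun ω => t ω = σ), Q ω with hq
  set n : S → ℝ := fun σ => ((Finset.univ.filter (fun ω => t ω = σ)).card : ℝ) with hn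
  have hopt : ∀ ω, optimalE t Q ω = if 0 < q (t ω) then n (t ω) * Q ω / q (t ω) else 1 :=
    fun ω => rfl
  have hq0 : ∀ σ, 0 ≤ q σ := fun σ => Finset.sum_nonneg fun ω _ => hQ0 ω
  have hnpos : ∀ ω, 0 < n (t ω) := by
    intro ω
    have : 0 < (Finset.univ.filter (fun ω' => t ω' = t ω)).card :=
      Finset.card_pos.2 ⟨ω, by simp⟩
    exact Nat.cast_pos.2 this
  have hqQ : ∀ ω, Q ω ≤ q (t ω) := fun ω =>
    Finset.single_le_sum (f := Q) (fun ω _ => hQ0 ω) (by simp)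
  refine ⟨⟨?_, ?_⟩, ?_⟩
  · intro ω
    rw [hopt]
    split_ifs with h
    · exact div_nonneg (mul_nonneg (hnpos ω).le (hQ0 ω)) h.le
    · exact zero_le_one
  · rintro _ ⟨ω₀, rfl⟩
    rw [div_le_one (hnpos ω₀)]
    have e : ∀ ω ∈ Finset.univ.filter (fun ω => t ω = t ω₀), optimalE t Q ω =
        if 0 < q (t ω₀) then n (t ω₀) / q (t ω₀) * Q ω else 1 := by
      intro ω hω
      rw [hopt, (Finset.mem_filter.1 hω).2]
      split_ifs
      · ring
      · rfl
    rw [Finset.sum_congr rfl e]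
    split_ifs with h
    · rw [← Finset.mul_sum]
      change n (t ω₀) / q (t ω₀) * q (t ω₀) ≤ n (t ω₀)
      rw [div_mul_cancel₀ _ h.ne']
    · simp [hn]
  · rintro E ⟨hE0, hE⟩
    by_cases hz : ∃ ω, 0 < Q ω ∧ E ω = 0
    · obtain ⟨ω, h1, h2⟩ := hz
      have : ePower Q E = ⊥ := by
        unfold ePower
        rw [← Finset.add_sum_erase _ _ (Finset.mem_filter.2 ⟨Finset.mem_univ ω, h1⟩),
          if_pos h2, EReal.coe_mul_bot_of_pos h1, EReal.bot_add]
      rw [this]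
      exact bot_le
    · push Not at hz
      have hF : ∀ ω, 0 < Q ω → 0 < optimalE t Q ω := by
        intro ω h
        have := h.trans_le (hqQ ω)
        rw [hopt, if_pos this]
        exact div_pos (mul_pos (hnpos ω) h) this
      rw [ePower_real_aux Q E hz, ePower_real_aux Q _ (fun ω h => (hF ω h).ne'),
        EReal.coe_le_coe_iff]
      have key : ∀ ω, 0 < Q ω → Q ω * Real.log (E ω) ≤
          Q ω * Real.log (optimalE t Q ω) + (E ω * (q (t ω) / n (t ω)) - Q ω) := by
        intro ω h
        have hEp : 0 < E ω := lt_of_le_of_ne (hE0 ω) (hz ω h).symm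
        have h1 := Real.log_le_sub_one_of_pos (div_pos hEp (hF ω h))
        rw [Real.log_div hEp.ne' (hF ω h).ne'] at h1
        have h2 := mul_le_mul_of_nonneg_left h1 h.le
        have hqp := h.trans_le (hqQ ω)
        have h3 : Q ω * (E ω / optimalE t Q ω) = E ω * (q (t ω) / n (t ω)) := by
          rw [hopt, if_pos hqp]
          have := hnpos ω
          field_simp
        linarith
      have hsum := Finset.sum_le_sum (s := Finset.univ.filter fun ω => 0 < Q ω)
        (fun ω hω => key ω (Finset.mem_filter.1 hω).2)
      rw [Finset.sum_add_distrib, Finset.sum_sub_distrib] at hsum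
      have hQs : ∑ ω ∈ Finset.univ.filter (fun ω => 0 < Q ω), Q ω = 1 := by
        rw [← hQ1]
        refine Finset.sum_subset (Finset.subset_univ _) fun ω _ h => ?_
        have : ¬ 0 < Q ω := by simpa using h
        exact le_antisymm (not_lt.1 this) (hQ0 ω)
      have hfib : ∀ g : Ω → ℝ, ∑ σ ∈ Finset.univ.image t,
          ∑ ω ∈ Finset.univ.filter (fun ω => t ω = σ), g ω = ∑ ω, g ω := fun g =>
        Finset.sum_fiberwise_of_maps_to (fun ω _ => Finset.mem_image_of_mem t (Finset.mem_univ ω)) g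
      have hB : ∑ ω ∈ Finset.univ.filter (fun ω => 0 < Q ω), E ω * (q (t ω) / n (t ω)) ≤ 1 := by
        calc _ ≤ ∑ ω, E ω * (q (t ω) / n (t ω)) :=
              Finset.sum_le_sum_of_subset_of_nonneg (Finset.subset_univ _) fun ω _ _ =>
                mul_nonneg (hE0 ω) (div_nonneg (hq0 _) (hnpos ω).le)
          _ ≤ ∑ ω, Q ω := by
              rw [← hfib, ← hfib Q]
              refine Finset.sum_le_sum fun σ hσ => ?_
              obtain ⟨ω₀, -, rfl⟩ := Finset.mem_image.1 hσ
              have e : ∀ ω ∈ Finset.univ.filter (fun ω => t ω = t ω₀),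
                  E ω * (q (t ω) / n (t ω)) = E ω * (q (t ω₀) / n (t ω₀)) := by
                intro ω hω
                rw [(Finset.mem_filter.1 hω).2]
              rw [Finset.sum_congr rfl e, ← Finset.sum_mul]
              have h1 := mul_le_mul_of_nonneg_left (hE _ ⟨ω₀, rfl⟩) (hq0 (t ω₀))
              calc _ = q (t ω₀) * ((∑ ω ∈ Finset.univ.filter (fun ω => t ω = t ω₀), E ω) /
                    n (t ω₀)) := by ring
                _ ≤ q (t ω₀) * 1 := h1
                _ = _ := mul_one _
          _ = 1 := hQ1
      linarith
end

section
/- Let z ∈ Ω = {0,1}^N with first bit F = z_1, bit counts N_0, N_1, and transition counts N_{ij}, and let B(z) = {z' ∈ Ω : z'_1 = z_1 and N_{ij}(z') = N_{ij}(z) for all i,j} be the set of sequences with the same Markov type. If z contains at least one occurrence of the bit 1−F, then Q(B(z)) = (1/2) · N_{F,1−F} · (N_0 − 1)! (N_1 − 1)! / ((N_{0*} + 1)! (N_{1*} + 1)!), where N_{i*} = N_{i0} + N_{i1}; if z contains no occurrence of the bit 1−F, then Q(B(z)) = 1/(2N). -/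
open Finset

/-- Number of 1s in a binary sequence. -/
def onesCount {N : ℕ} (z : Fin N → Bool) : ℕ :=
  (Finset.univ.filter fun n => z n = true).card

/-- Number of 0s in a binary sequence. -/
def zerosCount {N : ℕ} (z : Fin N → Bool) : ℕ := N - onesCount z

/-- `transCount z i j` is the number of indices `n ∈ {0,…,N−2}` with
`(z_n, z_{n+1}) = (i, j)`. -/
def transCount {N : ℕ} (z : Fin N → Bool) (i j : Bool) : ℕ :=
  (Finset.univ.filter fun n : Fin (N - 1) =>
    z ⟨n.1, by have := n.2; omega⟩ = i ∧ z ⟨n.1 + 1, by have := n.2; omega⟩ = j).card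

/-- The UMM (uniformly mixed Markov) alternative probability of a single
sequence `z`. -/
noncomputable def QummSingle {N : ℕ} (z : Fin N → Bool) : ℝ :=
  (1 / 2) * ∫ p in (0:ℝ)..1, ∫ q in (0:ℝ)..1,
    (1 - p) ^ transCount z false false * p ^ transCount z false true *
      q ^ transCount z true false * (1 - q) ^ transCount z true true

/-- The set of sequences with the same Markov type as `z`
(same first bit and same transition counts). -/
def sameMarkovType {N : ℕ} (hN : 0 < N) (z : Fin N → Bool) :
    Finset (Fin N → Bool) :=
  Finset.univ.filter fun z' =>
    z' ⟨0, hN⟩ = z ⟨0, hN⟩ ∧ ∀ i j, transCount z' i j = transCount z i j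


theorem beta_nat (a b : ℕ) : ∫ p in (0:ℝ)..1, (1 - p) ^ a * p ^ b =
    (a.factorial * b.factorial : ℝ) / ((a + b + 1).factorial) := by
  induction a generalizing b with
  | zero =>
    simp [Nat.factorial_succ]
    have : (b.factorial : ℝ) ≠ 0 := by positivity
    field_simp
  | succ a ih =>
    have h : ∀ p : ℝ, (1 - p) ^ (a + 1) * p ^ b
        = (1 - p) ^ a * p ^ b - (1 - p) ^ a * p ^ (b + 1) := by intro p; ring
    simp_rw [h]
    rw [intervalIntegral.integral_sub, ih, ih]
    · rw [show a + (b + 1) + 1 = (a + b + 1) + 1 by ring,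
        show a + 1 + b + 1 = (a + b + 1) + 1 by ring]
      rw [Nat.factorial_succ (a + b + 1), Nat.factorial_succ a, Nat.factorial_succ b]
      have : ((a + b + 1).factorial : ℝ) ≠ 0 := by positivity
      have h2 : ((a : ℝ) + b + 1 + 1) ≠ 0 := by positivity
      push_cast
      field_simp
      ring
    · apply Continuous.intervalIntegrable; fun_prop
    · apply Continuous.intervalIntegrable; fun_prop

theorem QummSingle_eq {N : ℕ} (z : Fin N → Bool) : QummSingle z = (1 / 2) *
    (((transCount z false false).factorial * (transCount z false true).factorial : ℝ) /
      ((transCount z false false + transCount z false true + 1).factorial) *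
    (((transCount z true false).factorial * (transCount z true true).factorial : ℝ) /
      ((transCount z true false + transCount z true true + 1).factorial))) := by
  unfold QummSingle
  congr 1
  generalize transCount z false false = a
  generalize transCount z false true = b
  generalize transCount z true false = c
  generalize transCount z true true = d
  have h : ∀ p q : ℝ, (1 - p) ^ a * p ^ b * q ^ c * (1 - q) ^ d =
      ((1 - p) ^ a * p ^ b) * ((1 - q) ^ d * q ^ c) := by intro p q; ring
  simp only [h, intervalIntegral.integral_const_mul, intervalIntegral.integral_mul_const,
    beta_nat]
  rw [add_comm d c, mul_comm (d.factorial : ℝ)]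

theorem transCount_cons {n : ℕ} (b : Bool) (z : Fin (n + 1) → Bool) (i j : Bool) :
    transCount (N := n + 2) (Fin.cons b z : Fin (n + 2) → Bool) i j =
      (if b = i ∧ z 0 = j then 1 else 0) + transCount z i j := by
  unfold transCount
  exact Fin.card_filter_univ_succ' (n := n) _

theorem onesCount_cons {n : ℕ} (b : Bool) (z : Fin n → Bool) :
    onesCount (Fin.cons b z : Fin (n + 1) → Bool) =
      (if b = true then 1 else 0) + onesCount z := by
  unfold onesCount
  exact Fin.card_filter_univ_succ' (n := n) _

theorem transCount_one (z : Fin 1 → Bool) (i j : Bool) : transCount z i j = 0 := by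
  unfold transCount
  exact Finset.card_eq_zero.2 (Finset.univ_eq_empty (α := Fin 0) ▸ rfl)

/-- Basic relations between counts. -/
theorem counts {n : ℕ} (z : Fin (n + 1) → Bool) :
    onesCount z = transCount z true true + transCount z false true +
      (if z 0 = true then 1 else 0) ∧
    n = transCount z true true + transCount z false true +
      transCount z true false + transCount z false false ∧
    transCount z (z 0) (!z 0) ≤ transCount z (!z 0) (z 0) + 1 ∧
    transCount z (!z 0) (z 0) ≤ transCount z (z 0) (!z 0) := by
  induction n with
  | zero =>
    simp only [transCount_one]
    have h := Fin.card_filter_univ_succ' (n := 0) (fun m => z m = true)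
    simp only [Finset.univ_eq_empty, Finset.filter_empty, Finset.card_empty] at h
    refine ⟨?_, by simp, by simp, by simp⟩
    unfold onesCount
    rw [h]; omega
  | succ n ih =>
    obtain ⟨b, y, rfl⟩ : ∃ b y, z = (Fin.cons b y : Fin (n + 2) → Bool) :=
      ⟨z 0, Fin.tail z, (Fin.cons_self_tail z).symm⟩
    have := ih y
    simp only [transCount_cons, onesCount_cons, Fin.cons_zero]
    cases b <;> cases h : y 0 <;> simp [h] at this ⊢ <;> omega

theorem const_of_zero {n : ℕ} (z : Fin (n + 1) → Bool)
    (h : transCount z (z 0) (!z 0) = 0) : ∀ m, z m = z 0 := by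
  intro m
  induction m using Fin.induction with
  | zero => rfl
  | succ k ih =>
    by_contra hne
    unfold transCount at h
    rw [Finset.card_eq_zero, Finset.filter_eq_empty_iff] at h
    refine h (Finset.mem_univ k) ⟨ih, ?_⟩
    have h2 : z k.succ = !z 0 := by
      revert hne; cases z k.succ <;> cases z 0 <;> simp
    exact h2

theorem zero_of_const {n : ℕ} (z : Fin (n + 1) → Bool) (i j : Bool)
    (hc : ∀ m, z m = z 0) (hij : i ≠ z 0 ∨ j ≠ z 0) : transCount z i j = 0 := by
  unfold transCount
  rw [Finset.card_eq_zero, Finset.filter_eq_empty_iff]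
  rintro k - ⟨h1, h2⟩
  rw [hc] at h1 h2
  rcases hij with h | h
  · exact h h1.symm
  · exact h h2.symm

theorem card_type (n : ℕ) (f : Bool) (s x y u : ℕ) (hn : n = s + x + y + u)
    (h1 : x ≤ y + 1) (h2 : y ≤ x) :
    ∑ z : Fin (n + 1) → Bool, (if z 0 = f ∧ transCount z f f = s ∧ transCount z f (!f) = x ∧
      transCount z (!f) f = y ∧ transCount z (!f) (!f) = u then 1 else 0) =
      Nat.multichoose (y + 1) s * Nat.multichoose x u := by
  induction n generalizing f s x y u with
  | zero =>
    obtain ⟨rfl, rfl, rfl, rfl⟩ : s = 0 ∧ x = 0 ∧ y = 0 ∧ u = 0 := by omega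
    simp only [transCount_one]
    rw [Fintype.sum_eq_single (fun _ => f)]
    · simp
    · intro z hz
      rw [if_neg]
      rintro ⟨h, -⟩
      exact hz (funext fun i => by rw [Subsingleton.elim (α := Fin 1) i 0]; exact h)
  | succ n ih =>
    rw [← (Fin.consEquiv (fun _ : Fin (n + 2) => Bool)).sum_comp, Fintype.sum_prod_type]
    simp only [Fin.consEquiv, Equiv.coe_fn_mk, transCount_cons, Fin.cons_zero]
    rw [Fintype.sum_eq_single f (fun b hb => Finset.sum_eq_zero fun z _ => by simp [hb])]
    have hA : ∑ z : Fin (n + 1) → Bool, (if z 0 = f ∧ transCount z f f + 1 = s ∧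
        transCount z f (!f) = x ∧
        transCount z (!f) f = y ∧ transCount z (!f) (!f) = u then 1 else 0) =
        if s = 0 then 0 else Nat.multichoose (y + 1) (s - 1) * Nat.multichoose x u := by
      cases s with
      | zero => simp
      | succ s =>
        simp only [Nat.add_right_cancel_iff]
        rw [ih f s x y u (by omega) h1 h2]; simp
    have hB : ∑ z : Fin (n + 1) → Bool, (if z 0 = !f ∧ transCount z f f = s ∧
        transCount z f (!f) + 1 = x ∧
        transCount z (!f) f = y ∧ transCount z (!f) (!f) = u then 1 else 0) =
        if x = 0 then 0 else Nat.multichoose x u * Nat.multichoose y s := by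
      cases x with
      | zero => simp
      | succ x =>
        have := ih (!f) u y x s (by omega) (by omega) (by omega)
        simp only [Bool.not_not] at this
        simp only [Nat.add_right_cancel_iff]
        rw [if_neg (by omega), ← this]
        refine Finset.sum_congr rfl fun z _ => if_congr ?_ rfl rfl
        tauto
    have hAB : Nat.multichoose (y + 1) s * Nat.multichoose x u =
      (if s = 0 then 0 else Nat.multichoose (y + 1) (s - 1) * Nat.multichoose x u) +
      (if x = 0 then 0 else Nat.multichoose x u * Nat.multichoose y s) := by
      rcases s with _ | s <;> rcases x with _ | x
      · obtain rfl : y = 0 := by omega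
        obtain ⟨u, rfl⟩ : ∃ v, u = v + 1 := ⟨u - 1, by omega⟩
        simp
      · simp
      · obtain rfl : y = 0 := by omega
        simp
      · rw [Nat.multichoose_succ_succ]; simp; ring
    rw [hAB, ← hA, ← hB, ← Finset.sum_add_distrib]
    refine Finset.sum_congr rfl fun z _ => ?_
    cases f <;> cases h : z 0 <;> simp [h, add_comm]

theorem card_same {n : ℕ} (z : Fin (n + 1) → Bool) :
    (sameMarkovType (Nat.succ_pos n) z).card =
      Nat.multichoose (transCount z (!z 0) (z 0) + 1) (transCount z (z 0) (z 0)) *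
      Nat.multichoose (transCount z (z 0) (!z 0)) (transCount z (!z 0) (!z 0)) := by
  obtain ⟨-, h2, h3, h4⟩ := counts z
  rw [← card_type n (z 0) _ _ _ _ ?_ h3 h4]
  · unfold sameMarkovType
    rw [Finset.card_filter]
    refine Finset.sum_congr rfl fun z' _ => if_congr ?_ rfl rfl
    change (z' 0 = z 0 ∧ _) ↔ _
    rw [Bool.forall_bool]
    simp only [Bool.forall_bool]
    cases z 0 <;> simp <;> tauto
  · generalize z 0 = f
    cases f <;> simp <;> omega

theorem sum_same {n : ℕ} (z : Fin (n + 1) → Bool) :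
    ∑ z' ∈ sameMarkovType (Nat.succ_pos n) z, QummSingle z' =
      (sameMarkovType (Nat.succ_pos n) z).card * QummSingle z := by
  rw [← nsmul_eq_mul]
  refine Finset.sum_eq_card_nsmul fun z' hz => ?_
  unfold sameMarkovType at hz
  rw [Finset.mem_filter] at hz
  rw [QummSingle_eq, QummSingle_eq]
  simp only [hz.2.2]

theorem multichoose_fact (y s : ℕ) :
    (Nat.multichoose (y + 1) s : ℝ) = (y + s).factorial / (y.factorial * s.factorial) := by
  rw [Nat.multichoose_eq, show y + 1 + s - 1 = y + s by omega,
    Nat.add_choose, Nat.cast_div]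
  · push_cast; rfl
  · exact Nat.factorial_mul_factorial_dvd_factorial_add y s
  · positivity

theorem Qumm_sameMarkovType (N : ℕ) (hN : 1 < N) (z : Fin N → Bool) :
    ((∃ n, z n = !z ⟨0, by omega⟩) →
      ∑ z' ∈ sameMarkovType (by omega) z, QummSingle z' =
        (1 / 2) * (transCount z (z ⟨0, by omega⟩) (!z ⟨0, by omega⟩) : ℝ) *
          (Nat.factorial (zerosCount z - 1)) * (Nat.factorial (onesCount z - 1)) /
          ((Nat.factorial (transCount z false false + transCount z false true + 1)) *
            (Nat.factorial (transCount z true false + transCount z true true + 1)))) ∧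
    ((∀ n, z n = z ⟨0, by omega⟩) →
      ∑ z' ∈ sameMarkovType (by omega) z, QummSingle z' = 1 / (2 * N)) := by
  obtain ⟨n, rfl⟩ : ∃ n, N = n + 1 := ⟨N - 1, by omega⟩
  have hz0 : ∀ h : 0 < n + 1, z ⟨0, h⟩ = z 0 := fun _ => rfl
  simp only [hz0]
  rw [sum_same, card_same, QummSingle_eq]
  obtain ⟨c1, c2, c3, c4⟩ := counts z
  constructor
  · rintro ⟨m, hm⟩
    have hx : transCount z (z 0) (!z 0) ≠ 0 := by
      intro h
      rw [const_of_zero z h m] at hm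
      revert hm; cases z 0 <;> simp
    have c5 : zerosCount z = transCount z false false + transCount z true false +
      (if z 0 = true then 0 else 1) := by
      unfold zerosCount; split_ifs at c1 ⊢ <;> omega
    rw [c5, c1]
    generalize z 0 = f at *
    obtain ⟨x, hx'⟩ := Nat.exists_eq_succ_of_ne_zero hx
    rw [hx']
    push_cast
    rw [Nat.succ_eq_add_one, multichoose_fact, multichoose_fact]
    cases f
    · simp only [Bool.not_false] at *
      rw [hx']
      simp
      rw [Nat.factorial_succ x, add_comm (transCount z true true) x,
        add_comm (transCount z true false) (transCount z false false)]
      push_cast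
      field_simp
    · simp only [Bool.not_true] at *
      rw [hx']
      simp
      rw [Nat.factorial_succ x, add_comm (transCount z false false) x,
        add_comm (transCount z false true) (transCount z true true)]
      push_cast
      field_simp
  · intro hc
    have e1 := zero_of_const z (z 0) (!z 0) hc (by simp)
    have e2 := zero_of_const z (!z 0) (z 0) hc (by simp)
    have e3 := zero_of_const z (!z 0) (!z 0) hc (by simp)
    rw [e1, e2, e3]
    generalize z 0 = f at *
    have hf : ((n + 1).factorial : ℝ) = (n + 1) * n.factorial := by
      rw [Nat.factorial_succ]; push_cast; ring
    have hp : (n.factorial : ℝ) ≠ 0 := by positivity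
    cases f
    · simp only [Bool.not_false] at *
      have : transCount z false false = n := by omega
      rw [e1, e2, e3, this]
      simp [hf]
      field_simp
    · simp only [Bool.not_true] at *
      have : transCount z true true = n := by omega
      rw [e1, e2, e3, this]
      simp [hf]
      field_simp
end

section
/- The exchangeability lower benchmark ELB is an exchangeability e-variable: for every k ∈ {0,…,N}, the arithmetic mean of ELB over the level set A_k is at most 1, i.e., (1/C(N,k)) ∑_{z ∈ A_k} ELB(z) ≤ 1. -/
open Finset

/-- The exchangeability lower benchmark. -/
noncomputable def ELB {N : ℕ} (z : Fin N → Bool) : ℝ :=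
  (1 / 2) * (N.choose (onesCount z) : ℝ) *
    ((Nat.factorial (transCount z false false)) *
      (Nat.factorial (transCount z false true)) *
      (Nat.factorial (transCount z true false)) *
      (Nat.factorial (transCount z true true))) /
    ((Nat.factorial (transCount z false false + transCount z false true + 1)) *
      (Nat.factorial (transCount z true false + transCount z true true + 1)))


/-- The Bayes mixture of Markov chains. -/
noncomputable def mixP {N : ℕ} (z : Fin N → Bool) : ℝ :=
  (1 / 2) *
    ((Nat.factorial (transCount z false false)) *
      (Nat.factorial (transCount z false true)) *
      (Nat.factorial (transCount z true false)) *
      (Nat.factorial (transCount z true true))) /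
    ((Nat.factorial (transCount z false false + transCount z false true + 1)) *
      (Nat.factorial (transCount z true false + transCount z true true + 1)))

lemma transCount_snoc (n : ℕ) (z : Fin (n + 1) → Bool) (b i j : Bool) :
    transCount (Fin.snoc (α := fun _ => Bool) z b : Fin (n + 2) → Bool) i j =
      transCount z i j + if z (Fin.last n) = i ∧ b = j then 1 else 0 := by
  unfold transCount
  rw [Finset.card_filter, Finset.card_filter]
  have h := Fin.sum_univ_castSucc (n := n) (fun m : Fin (n + 1) =>
    if (Fin.snoc (α := fun _ => Bool) z b : Fin (n + 2) → Bool) ⟨m.1, by omega⟩ = i ∧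
      (Fin.snoc (α := fun _ => Bool) z b : Fin (n + 2) → Bool) ⟨m.1 + 1, by omega⟩ = j
      then 1 else 0)
  refine h.trans ?_
  congr 1
  · refine Finset.sum_congr rfl fun m _ => ?_
    have hm := m.2
    simp [Fin.snoc, Fin.castLT, hm, Nat.lt_succ_of_lt hm]
  · simp [Fin.snoc, Fin.castLT, Fin.last]

lemma mixP_snoc (n : ℕ) (z : Fin (n + 1) → Bool) :
    mixP (Fin.snoc (α := fun _ => Bool) z false : Fin (n + 2) → Bool) +
    mixP (Fin.snoc (α := fun _ => Bool) z true : Fin (n + 2) → Bool) = mixP z := by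
  unfold mixP
  simp only [transCount_snoc]
  generalize transCount z false false = a
  generalize transCount z false true = b
  generalize transCount z true false = c
  generalize transCount z true true = d
  have e1 : a + 1 + b + 1 = (a + b + 1) + 1 := by ring
  have e2 : a + (b + 1) + 1 = (a + b + 1) + 1 := by ring
  have e3 : c + 1 + d + 1 = (c + d + 1) + 1 := by ring
  have e4 : c + (d + 1) + 1 = (c + d + 1) + 1 := by ring
  have f1 : ((a + b + 1).factorial : ℝ) ≠ 0 := by positivity
  have f2 : ((c + d + 1).factorial : ℝ) ≠ 0 := by positivity
  have g1 : ((a : ℝ) + b + 1 + 1) ≠ 0 := by positivity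
  have g2 : ((c : ℝ) + d + 1 + 1) ≠ 0 := by positivity
  cases z (Fin.last n)
  · simp only [reduceCtorEq, and_true, and_false, if_true, if_false, add_zero, e1, e2]
    rw [Nat.factorial_succ a, Nat.factorial_succ b, Nat.factorial_succ (a + b + 1)]
    push_cast
    field_simp
    ring
  · simp only [reduceCtorEq, and_true, and_false, if_true, if_false, add_zero, e3, e4]
    rw [Nat.factorial_succ c, Nat.factorial_succ d, Nat.factorial_succ (c + d + 1)]
    push_cast
    field_simp
    ring

lemma sum_mixP (n : ℕ) : ∑ z : Fin (n + 1) → Bool, mixP z = 1 := by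
  induction n with
  | zero =>
    have h : ∀ z : Fin (0 + 1) → Bool, mixP z = 1 / 2 := by
      intro z
      have : ∀ i j, transCount z i j = 0 := by
        intro i j
        unfold transCount
        exact Finset.card_eq_zero.2 (Finset.eq_empty_of_forall_notMem fun m => m.elim0)
      simp [mixP, this]
    simp [h]
  | succ n ih =>
    rw [← ih, ← (Fin.snocEquiv (fun _ : Fin (n + 2) => Bool)).sum_comp, Fintype.sum_prod_type,
      Finset.sum_comm]
    refine Finset.sum_congr rfl fun z _ => ?_
    rw [← mixP_snoc, Fintype.sum_bool, add_comm]
    rfl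

lemma card_level (N k : ℕ) :
    (Finset.univ.filter fun z : Fin N → Bool => onesCount z = k).card = N.choose k := by
  have h : (Finset.powersetCard k (Finset.univ : Finset (Fin N))).card = N.choose k := by simp
  rw [← h]
  refine Finset.card_bij' (fun z _ => Finset.univ.filter fun n => z n = true)
    (fun s _ => fun n => decide (n ∈ s)) ?_ ?_ ?_ ?_
  · intro z hz
    exact Finset.mem_powersetCard.2 ⟨Finset.subset_univ _, (Finset.mem_filter.1 hz).2⟩
  · intro s hs
    refine Finset.mem_filter.2 ⟨Finset.mem_univ _, ?_⟩
    have hs2 := (Finset.mem_powersetCard.1 hs).2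
    simpa [onesCount] using hs2
  · intro z _
    ext n
    simp
  · intro s _
    ext n
    simp

theorem ELB_is_exchangeability_evariable (N : ℕ) (hN : 1 < N) :
    ∀ k ≤ N,
      (∑ z ∈ Finset.univ.filter fun z : Fin N → Bool => onesCount z = k, ELB z) /
        ((Finset.univ.filter fun z : Fin N → Bool => onesCount z = k).card : ℝ) ≤ 1 := by
  intro k _
  apply div_le_one_of_le₀ _ (Nat.cast_nonneg _)
  rw [card_level]
  have h1 : ∑ z ∈ Finset.univ.filter (fun z : Fin N → Bool => onesCount z = k), ELB z =
      (N.choose k : ℝ) *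
        ∑ z ∈ Finset.univ.filter (fun z : Fin N → Bool => onesCount z = k), mixP z := by
    rw [Finset.mul_sum]
    refine Finset.sum_congr rfl fun z hz => ?_
    rw [Finset.mem_filter] at hz
    unfold ELB mixP
    rw [hz.2]
    ring
  have h2 : ∑ z ∈ Finset.univ.filter (fun z : Fin N → Bool => onesCount z = k), mixP z ≤ 1 := by
    obtain ⟨n, rfl⟩ : ∃ n, N = n + 1 := ⟨N - 1, by omega⟩
    rw [← sum_mixP n]
    refine Finset.sum_le_sum_of_subset_of_nonneg (Finset.filter_subset _ _) fun z _ _ => ?_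
    unfold mixP
    positivity
  rw [h1]
  exact mul_le_of_le_one_right (Nat.cast_nonneg _) h2
end

section
/- As the horizon N tends to infinity, the normalized e-power of the UMM e-variable under the UMM alternative converges: lim_{N→∞} (1/N) ∑_{z ∈ Ω_N} Q_N({z}) ln UMM_N(z) = (8/3) ln 2 + (2/3)(ln 2)^2 − (7/36) π² − 1/6 (approximately 0.083); the same limit holds with the exchangeability lower benchmark ELB_N in place of UMM_N. -/
open Finset

/-- The UMM probability of the set `A_k` of sequences with exactly `k` ones. -/
noncomputable def QummLevel (N k : ℕ) : ℝ :=
  ∑ z ∈ Finset.univ.filter fun z : Fin N → Bool => onesCount z = k, QummSingle z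

/-- The UMM e-variable. -/
noncomputable def UMM {N : ℕ} (z : Fin N → Bool) : ℝ :=
  ELB z / QummLevel N (onesCount z)

open Finset

/-- Path weight of a kernel. -/
noncomputable def pathP {m : ℕ} (k : Bool → Bool → ℝ) (z : Fin (m+1) → Bool) : ℝ :=
  ∏ n : Fin m, k (z n.castSucc) (z n.succ)

noncomputable def pathS {m : ℕ} (d : Bool → Bool → ℝ) (z : Fin (m+1) → Bool) : ℝ :=
  ∑ n : Fin m, d (z n.castSucc) (z n.succ)

lemma pathP_cons {m : ℕ} (k : Bool → Bool → ℝ) (a : Bool) (z : Fin (m+1) → Bool) :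
    pathP k (Fin.cons a z : Fin (m+2) → Bool) = k a (z 0) * pathP k z := by
  unfold pathP
  rw [Fin.prod_univ_succ]
  simp [Fin.cons_succ]

lemma pathS_cons {m : ℕ} (k : Bool → Bool → ℝ) (a : Bool) (z : Fin (m+1) → Bool) :
    pathS k (Fin.cons a z : Fin (m+2) → Bool) = k a (z 0) + pathS k z := by
  unfold pathS
  rw [Fin.sum_univ_succ]
  simp [Fin.cons_succ]

lemma sum_bcons {m : ℕ} (f : (Fin (m+1) → Bool) → ℝ) :
    ∑ z, f z = ∑ a : Bool, ∑ z : Fin m → Bool, f (Fin.cons a z) := by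
  rw [← (Fin.consEquiv (fun _ : Fin (m+1) => Bool)).sum_comp, Fintype.sum_prod_type]
  rfl

lemma path_mass (k : Bool → Bool → ℝ) (hk : ∀ a, ∑ b, k a b = 1) (m : ℕ) (a : Bool) :
    ∑ z : Fin m → Bool, pathP k (Fin.cons a z : Fin (m+1) → Bool) = 1 := by
  induction m generalizing a with
  | zero => simp [pathP]
  | succ m ih =>
    rw [sum_bcons]
    simp_rw [pathP_cons, Fin.cons_zero, ← Finset.mul_sum, ih, mul_one]
    exact hk a

lemma path_mean (k d : Bool → Bool → ℝ) (hk : ∀ a, ∑ b, k a b = 1)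
    (hd : ∀ a, ∑ b, k a b * d a b = 0) (m : ℕ) (a : Bool) :
    ∑ z : Fin m → Bool, pathP k (Fin.cons a z : Fin (m+1) → Bool) *
      pathS d (Fin.cons a z : Fin (m+1) → Bool) = 0 := by
  induction m generalizing a with
  | zero => simp [pathS]
  | succ m ih =>
    rw [sum_bcons]
    simp_rw [pathP_cons, pathS_cons, Fin.cons_zero]
    rw [← hd a]
    refine Finset.sum_congr rfl fun b _ => ?_
    have : ∀ z : Fin m → Bool, k a b * pathP k (Fin.cons b z : Fin (m+1) → Bool) *
        (d a b + pathS d (Fin.cons b z : Fin (m+1) → Bool)) =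
        (k a b * d a b) * pathP k (Fin.cons b z : Fin (m+1) → Bool) +
        k a b * (pathP k (Fin.cons b z : Fin (m+1) → Bool) *
          pathS d (Fin.cons b z : Fin (m+1) → Bool)) := fun z => by ring
    simp_rw [this, Finset.sum_add_distrib, ← Finset.mul_sum, ih, path_mass k hk]
    ring

lemma path_var (k d : Bool → Bool → ℝ) (hk0 : ∀ a b, 0 ≤ k a b) (hk : ∀ a, ∑ b, k a b = 1)
    (hd : ∀ a, ∑ b, k a b * d a b = 0) (hd1 : ∀ a b, (d a b)^2 ≤ 1) (m : ℕ) (a : Bool) :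
    ∑ z : Fin m → Bool, pathP k (Fin.cons a z : Fin (m+1) → Bool) *
      (pathS d (Fin.cons a z : Fin (m+1) → Bool))^2 ≤ m := by
  induction m generalizing a with
  | zero => simp [pathS]
  | succ m ih =>
    rw [sum_bcons]
    simp_rw [pathP_cons, pathS_cons, Fin.cons_zero]
    have h1 : ∀ b, ∑ z : Fin m → Bool, k a b * pathP k (Fin.cons b z : Fin (m+1) → Bool) *
        (d a b + pathS d (Fin.cons b z : Fin (m+1) → Bool))^2 ≤ k a b * (1 + m) := by
      intro b
      have : ∀ z : Fin m → Bool, k a b * pathP k (Fin.cons b z : Fin (m+1) → Bool) *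
        (d a b + pathS d (Fin.cons b z : Fin (m+1) → Bool))^2 =
        (k a b * (d a b)^2) * pathP k (Fin.cons b z : Fin (m+1) → Bool) +
        (2 * k a b * d a b) * (pathP k (Fin.cons b z : Fin (m+1) → Bool) *
          pathS d (Fin.cons b z : Fin (m+1) → Bool)) +
        k a b * (pathP k (Fin.cons b z : Fin (m+1) → Bool) *
          (pathS d (Fin.cons b z : Fin (m+1) → Bool))^2) := fun z => by ring
      simp_rw [this, Finset.sum_add_distrib, ← Finset.mul_sum, path_mass k hk,
        path_mean k d hk hd]
      have := mul_le_mul_of_nonneg_left (ih b) (hk0 a b)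
      have := mul_le_mul_of_nonneg_left (hd1 a b) (hk0 a b)
      linarith
    calc _ ≤ ∑ b, k a b * (1 + (m:ℝ)) := Finset.sum_le_sum fun b _ => h1 b
      _ = _ := by rw [← Finset.sum_mul, hk]; push_cast; ring

lemma path_var' (k d : Bool → Bool → ℝ) (hk0 : ∀ a b, 0 ≤ k a b) (hk : ∀ a, ∑ b, k a b = 1)
    (hd : ∀ a, ∑ b, k a b * d a b = 0) (hd1 : ∀ a b, (d a b)^2 ≤ 1) (m : ℕ) :
    ∑ z : Fin (m+1) → Bool, (1/2) * pathP k z * (pathS d z)^2 ≤ (m:ℝ) := by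
  rw [sum_bcons]
  simp_rw [mul_assoc, ← Finset.mul_sum]
  simp only [Fintype.sum_bool]
  linarith [path_var k d hk0 hk hd hd1 m true, path_var k d hk0 hk hd hd1 m false]

lemma path_mass' (k : Bool → Bool → ℝ) (hk : ∀ a, ∑ b, k a b = 1) (m : ℕ) :
    ∑ z : Fin (m+1) → Bool, (1/2) * pathP k z = 1 := by
  rw [sum_bcons]
  simp_rw [← Finset.mul_sum]
  simp only [Fintype.sum_bool]
  linarith [path_mass k hk m true, path_mass k hk m false]

lemma transCount_eq {m : ℕ} (z : Fin (m+1) → Bool) (i j : Bool) :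
    transCount z i j = ∑ n : Fin m, if z n.castSucc = i ∧ z n.succ = j then 1 else 0 := by
  unfold transCount
  rw [Finset.card_filter]
  rfl

lemma pathP_eq {m : ℕ} (k : Bool → Bool → ℝ) (z : Fin (m+1) → Bool) :
    pathP k z = k false false ^ transCount z false false * k false true ^ transCount z false true *
      k true false ^ transCount z true false * k true true ^ transCount z true true := by
  simp_rw [transCount_eq, ← Finset.prod_pow_eq_pow_sum, ← Finset.prod_mul_distrib]
  refine Finset.prod_congr rfl fun n _ => ?_
  cases z n.castSucc <;> cases z n.succ <;> simp

lemma pathS_eq {m : ℕ} (k : Bool → Bool → ℝ) (z : Fin (m+1) → Bool) :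
    pathS k z = k false false * transCount z false false + k false true * transCount z false true +
      k true false * transCount z true false + k true true * transCount z true true := by
  simp_rw [transCount_eq]
  push_cast
  simp_rw [Finset.mul_sum, ← Finset.sum_add_distrib]
  refine Finset.sum_congr rfl fun n _ => ?_
  cases z n.castSucc <;> cases z n.succ <;> simp

lemma trans_total {m : ℕ} (z : Fin (m+1) → Bool) :
    transCount z false false + transCount z false true + transCount z true false +
      transCount z true true = m := by
  simp_rw [transCount_eq, ← Finset.sum_add_distrib]
  calc _ = ∑ n : Fin m, 1 := by
        refine Finset.sum_congr rfl fun n _ => ?_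
        cases z n.castSucc <;> cases z n.succ <;> simp
    _ = m := by simp

lemma ones_last {m : ℕ} (z : Fin (m+1) → Bool) :
    onesCount z = transCount z true false + transCount z true true +
      (if z (Fin.last m) = true then 1 else 0) := by
  unfold onesCount
  rw [Finset.card_filter, Fin.sum_univ_castSucc]
  congr 1
  simp_rw [transCount_eq, ← Finset.sum_add_distrib]
  refine Finset.sum_congr rfl fun n _ => ?_
  cases z n.castSucc <;> cases z n.succ <;> simp

lemma ones_first {m : ℕ} (z : Fin (m+1) → Bool) :
    onesCount z = (if z 0 = true then 1 else 0) + (transCount z false true + transCount z true true)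
      := by
  unfold onesCount
  rw [Finset.card_filter, Fin.sum_univ_succ]
  congr 1
  simp_rw [transCount_eq, ← Finset.sum_add_distrib]
  refine Finset.sum_congr rfl fun n _ => ?_
  cases z n.castSucc <;> cases z n.succ <;> simp
open Finset

lemma log_step_upper (n : ℕ) : (n:ℝ) * (Real.log (n+1) - Real.log n) ≤ 1 := by
  rcases Nat.eq_zero_or_pos n with h | h
  · subst h; simp
  have hn : (0:ℝ) < n := by exact_mod_cast h
  rw [← Real.log_div (by positivity) (by positivity)]
  have := Real.log_le_sub_one_of_pos (show (0:ℝ) < (n+1)/n by positivity)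
  calc (n:ℝ) * Real.log ((n+1)/n) ≤ n * ((n+1)/n - 1) := by gcongr
    _ = 1 := by field_simp; ring

lemma log_step_lower (n : ℕ) (h : 0 < n) : 1 ≤ ((n:ℝ)+1) * (Real.log (n+1) - Real.log n) := by
  have hn : (0:ℝ) < n := by exact_mod_cast h
  rw [← Real.log_div (by positivity) (by positivity)]
  have := Real.one_sub_inv_le_log_of_pos (show (0:ℝ) < (n+1)/n by positivity)
  calc (1:ℝ) = ((n:ℝ)+1) * (1 - (((n:ℝ)+1)/n)⁻¹) := by field_simp; ring
    _ ≤ _ := by gcongr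

lemma log_fac_succ (n : ℕ) : Real.log ((n+1).factorial) = Real.log (n.factorial) + Real.log (n+1) := by
  rw [Nat.factorial_succ]
  push_cast
  rw [Real.log_mul (by positivity) (by positivity)]
  ring

lemma logfac_lower (n : ℕ) : n * Real.log n - n ≤ Real.log (n.factorial) := by
  induction n with
  | zero => simp
  | succ n ih =>
    rw [log_fac_succ]
    have := log_step_upper n
    push_cast
    linarith

lemma logfac_upper (n : ℕ) : Real.log (n.factorial) ≤ n * Real.log n - n + (1 + Real.log (n+1)) := by
  have h : Real.log (n.factorial) ≤ (n+1) * Real.log (n+1) - n := by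
    induction n with
    | zero => simp
    | succ n ih =>
      rw [log_fac_succ]
      have := log_step_lower (n+1) (by omega)
      push_cast at *
      linarith
  have := log_step_upper n
  linarith

lemma logfac_scaled (N n : ℕ) (hN : 0 < N) (hn : n ≤ N) :
    ∃ r : ℝ, 0 ≤ r ∧ r ≤ 1 + Real.log (N+1) ∧
      Real.log (n.factorial) = - N * Real.negMulLog ((n:ℝ)/N) + n * Real.log N - n + r := by
  have hN' : (0:ℝ) < N := by exact_mod_cast hN
  have key : - N * Real.negMulLog ((n:ℝ)/N) + n * Real.log N = n * Real.log n := by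
    rcases Nat.eq_zero_or_pos n with h | h
    · subst h; simp
    have hn' : (0:ℝ) < n := by exact_mod_cast h
    rw [Real.negMulLog, Real.log_div (by positivity) (by positivity)]
    field_simp
    ring
  refine ⟨Real.log n.factorial - (n * Real.log n - n), ?_, ?_, ?_⟩
  · linarith [logfac_lower n]
  · have : Real.log (n+1) ≤ Real.log (N+1) := by
      apply Real.log_le_log (by positivity)
      have : (n:ℝ) ≤ N := by exact_mod_cast hn
      linarith
    linarith [logfac_upper n]
  · rw [key]; ring

noncomputable def PsiN {m : ℕ} (z : Fin (m+1) → Bool) : ℝ :=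
  2 * Real.negMulLog (((transCount z false false + transCount z false true : ℕ) : ℝ) / ((m+1 : ℕ):ℝ))
  + 2 * Real.negMulLog (((transCount z true false + transCount z true true : ℕ) : ℝ) / ((m+1 : ℕ):ℝ))
  - Real.negMulLog ((transCount z false false : ℝ) / ((m+1 : ℕ):ℝ))
  - Real.negMulLog ((transCount z false true : ℝ) / ((m+1 : ℕ):ℝ))
  - Real.negMulLog ((transCount z true false : ℝ) / ((m+1 : ℕ):ℝ))
  - Real.negMulLog ((transCount z true true : ℝ) / ((m+1 : ℕ):ℝ))

lemma ELB_pos {m : ℕ} (z : Fin (m+1) → Bool) : 0 < ELB z := by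
  unfold ELB
  have h := trans_total z
  have h1 := ones_last z
  have : onesCount z ≤ m+1 := by split_ifs at h1 <;> omega
  have := Nat.choose_pos this
  positivity

lemma ELB_approx {m : ℕ} (z : Fin (m+1) → Bool) :
    |Real.log (ELB z) - ((m+1 : ℕ):ℝ) * PsiN z| ≤ 20 * (1 + Real.log (((m+1 : ℕ):ℝ)+1)) := by
  have hpos := ELB_pos z
  have h := trans_total z
  have h1 := ones_last z
  unfold PsiN
  unfold ELB at *
  generalize transCount z false false = a at *
  generalize transCount z false true = b at *
  generalize transCount z true false = c at *
  generalize transCount z true true = d at *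
  obtain ⟨w, x, hw, hx, hones, hz⟩ : ∃ w x, (w = a + b ∨ w = c + d) ∧ x = onesCount z ∧ x ≤ m+1 ∧
      Real.log (x.factorial) + Real.log ((m+1-x).factorial) =
      Real.log ((a+b).factorial) + Real.log ((c+d).factorial) + Real.log (w+1) := by
    split_ifs at h1
    · refine ⟨c+d, _, Or.inr rfl, rfl, by omega, ?_⟩
      rw [h1, show m + 1 - (c+d+1) = a+b by omega, log_fac_succ]; push_cast; ring
    · refine ⟨a+b, _, Or.inl rfl, rfl, by omega, ?_⟩
      rw [h1, show m + 1 - (c+d+0) = a+b+1 by omega, log_fac_succ]; push_cast; ring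
  rw [← hx] at *
  have hch : Real.log ((m+1).choose x) = Real.log ((m+1).factorial) -
      (Real.log (x.factorial) + Real.log ((m+1-x).factorial)) := by
    rw [Nat.choose_eq_factorial_div_factorial hones,
      Nat.cast_div (Nat.factorial_mul_factorial_dvd_factorial hones) (by positivity)]
    push_cast
    rw [Real.log_div (by positivity) (by positivity), Real.log_mul (by positivity) (by positivity)]
  have hcp : (0:ℝ) < (m+1).choose x := by exact_mod_cast Nat.choose_pos hones
  have hlog : Real.log (1 / 2 * ((m + 1).choose x : ℝ) *
          (a.factorial * b.factorial * c.factorial * d.factorial) /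
        ((a + b + 1).factorial * (c + d + 1).factorial)) =
      - Real.log 2 + Real.log ((m+1).choose x) + (Real.log a.factorial + Real.log b.factorial +
        Real.log c.factorial + Real.log d.factorial) - (Real.log ((a+b+1).factorial) +
        Real.log ((c+d+1).factorial)) := by
    rw [Real.log_div (by positivity) (by positivity), Real.log_mul (by positivity) (by positivity),
      Real.log_mul (by positivity) (by positivity), Real.log_mul (by positivity) (by positivity),
      Real.log_mul (by positivity) (by positivity), Real.log_mul (by positivity) (by positivity),
      Real.log_mul (by positivity) (by positivity)]
    rw [one_div, Real.log_inv]
  have hlb : ∀ n : ℕ, n ≤ m+1 → 0 ≤ Real.log ((n:ℝ)+1) ∧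
      Real.log ((n:ℝ)+1) ≤ Real.log (((m+1:ℕ):ℝ)+1) := by
    intro n hn
    refine ⟨Real.log_nonneg (by linarith [n.cast_nonneg (α := ℝ)]), ?_⟩
    apply Real.log_le_log (by positivity)
    have : (n:ℝ) ≤ (m+1:ℕ) := by exact_mod_cast hn
    linarith
  have hN0 : 0 ≤ Real.log ((m+1:ℕ):ℝ) := Real.log_nonneg (by push_cast; linarith [m.cast_nonneg (α := ℝ)])
  have hN1 : Real.log ((m+1:ℕ):ℝ) ≤ Real.log (((m+1:ℕ):ℝ)+1) :=
    Real.log_le_log (by positivity) (by linarith)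
  have h2 : 0 ≤ Real.log 2 := Real.log_nonneg (by norm_num)
  have h3 : Real.log 2 ≤ 1 := by linarith [Real.log_two_lt_d9]
  obtain ⟨r0, r0a, r0b, r0c⟩ := logfac_scaled (m+1) (m+1) (by omega) le_rfl
  obtain ⟨r1, r1a, r1b, r1c⟩ := logfac_scaled (m+1) (a+b) (by omega) (by omega)
  obtain ⟨r2, r2a, r2b, r2c⟩ := logfac_scaled (m+1) (c+d) (by omega) (by omega)
  obtain ⟨r3, r3a, r3b, r3c⟩ := logfac_scaled (m+1) a (by omega) (by omega)
  obtain ⟨r4, r4a, r4b, r4c⟩ := logfac_scaled (m+1) b (by omega) (by omega)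
  obtain ⟨r5, r5a, r5b, r5c⟩ := logfac_scaled (m+1) c (by omega) (by omega)
  obtain ⟨r6, r6a, r6b, r6c⟩ := logfac_scaled (m+1) d (by omega) (by omega)
  have e0 : Real.negMulLog (((m+1:ℕ):ℝ)/((m+1:ℕ):ℝ)) = 0 := by
    rw [div_self (by positivity)]; simp
  have hab := hlb (a+b) (by omega)
  have hcd := hlb (c+d) (by omega)
  have hww := hlb w (by rcases hw with rfl | rfl <;> omega)
  rw [hlog, hch, hz, log_fac_succ (a+b), log_fac_succ (c+d), r0c, r1c, r2c, r3c, r4c, r5c, r6c, e0]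
  generalize Real.log (((m+1:ℕ):ℝ)+1) = T at *
  generalize Real.log (((m+1:ℕ):ℝ)) = U at *
  have hm : (m:ℝ) = a + b + c + d := by exact_mod_cast h.symm
  have hNm : ((m+1:ℕ):ℝ) = a + b + c + d + 1 := by push_cast; linarith
  generalize ((m+1:ℕ):ℝ) = N at *
  generalize Real.negMulLog (((a+b:ℕ):ℝ)/N) = n1 at *
  generalize Real.negMulLog (((c+d:ℕ):ℝ)/N) = n2 at *
  generalize Real.negMulLog ((a:ℝ)/N) = n3 at *
  generalize Real.negMulLog ((b:ℝ)/N) = n4 at *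
  generalize Real.negMulLog ((c:ℝ)/N) = n5 at *
  generalize Real.negMulLog ((d:ℝ)/N) = n6 at *
  generalize Real.log (((a+b:ℕ):ℝ)+1) = l1 at *
  generalize Real.log (((c+d:ℕ):ℝ)+1) = l2 at *
  generalize Real.log ((w:ℝ)+1) = l3 at *
  generalize Real.log 2 = l4 at *
  have : ∀ E : ℝ, E = -l4 + U - 1 - l1 - l2 - l3 + r0 - 2*r1 - 2*r2 + r3 + r4 + r5 + r6 →
      |E| ≤ 20 * (1 + T) := by
    intro E hE
    rw [hE, abs_le]
    constructor <;> linarith [hab.1, hab.2, hcd.1, hcd.2, hww.1, hww.2]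
  apply this
  push_cast
  rw [hNm]
  ring

lemma negMulLog_le_one {x : ℝ} (h0 : 0 ≤ x) : Real.negMulLog x ≤ 1 := by
  rcases h0.eq_or_lt with h | h
  · subst h; simp
  have := Real.one_sub_inv_le_log_of_pos h
  have h2 := mul_le_mul_of_nonneg_left this h0
  rw [mul_sub, mul_inv_cancel₀ h.ne'] at h2
  unfold Real.negMulLog
  linarith

lemma negMulLog_modulus (ε : ℝ) (hε : 0 < ε) : ∃ C : ℝ, 0 ≤ C ∧ ∀ x ∈ Set.Icc (0:ℝ) 1,
    ∀ y ∈ Set.Icc (0:ℝ) 1, |Real.negMulLog x - Real.negMulLog y| ≤ ε + C * (x - y)^2 := by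
  have huc := isCompact_Icc.uniformContinuousOn_of_continuous
    (Real.continuous_negMulLog.continuousOn (s := Set.Icc (0:ℝ) 1))
  rw [Metric.uniformContinuousOn_iff] at huc
  obtain ⟨δ, hδ, h⟩ := huc ε hε
  refine ⟨1/δ^2, by positivity, fun x hx y hy => ?_⟩
  by_cases hxy : dist x y < δ
  · have := (h x hx y hy hxy).le
    rw [Real.dist_eq] at this
    have : 0 ≤ 1/δ^2 * (x-y)^2 := by positivity
    linarith
  · rw [Real.dist_eq, not_lt] at hxy
    have h1 : 1 ≤ 1/δ^2 * (x-y)^2 := by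
      rw [← sq_abs (x-y), one_div, inv_mul_eq_div, le_div_iff₀ (by positivity), one_mul]
      gcongr
    have a1 := negMulLog_le_one hx.1
    have a2 := negMulLog_le_one hy.1
    have a3 := Real.negMulLog_nonneg hx.1 hx.2
    have a4 := Real.negMulLog_nonneg hy.1 hy.2
    have : |Real.negMulLog x - Real.negMulLog y| ≤ 1 := by
      rw [abs_le]; constructor <;> linarith
    linarith
open Finset

/-- Markov kernel. -/
noncomputable def mker (p q : ℝ) : Bool → Bool → ℝ
  | false, false => 1 - p
  | false, true => p
  | true, false => q
  | true, true => 1 - q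

noncomputable def d1 (p : ℝ) : Bool → Bool → ℝ
  | false, false => - p
  | false, true => 1 - p
  | true, _ => 0

noncomputable def d2 (q : ℝ) : Bool → Bool → ℝ
  | false, _ => 0
  | true, false => 1 - q
  | true, true => - q

noncomputable def EM (p q : ℝ) {m : ℕ} (f : (Fin (m+1) → Bool) → ℝ) : ℝ :=
  ∑ z : Fin (m+1) → Bool, (1/2) * pathP (mker p q) z * f z

lemma mk_nonneg {p q : ℝ} (hp : p ∈ Set.Icc (0:ℝ) 1) (hq : q ∈ Set.Icc (0:ℝ) 1) (a b : Bool) :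
    0 ≤ mker p q a b := by
  obtain ⟨h1, h2⟩ := hp
  obtain ⟨h3, h4⟩ := hq
  cases a <;> cases b <;> simp [mker] <;> linarith

lemma mk_sum (p q : ℝ) (a : Bool) : ∑ b, mker p q a b = 1 := by
  cases a <;> simp [mker]

lemma weight_nonneg {p q : ℝ} (hp : p ∈ Set.Icc (0:ℝ) 1) (hq : q ∈ Set.Icc (0:ℝ) 1) {m : ℕ}
    (z : Fin (m+1) → Bool) : 0 ≤ (1/2) * pathP (mker p q) z := by
  have : 0 ≤ pathP (mker p q) z := Finset.prod_nonneg fun n _ => mk_nonneg hp hq _ _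
  positivity

lemma EM_mono {p q : ℝ} (hp : p ∈ Set.Icc (0:ℝ) 1) (hq : q ∈ Set.Icc (0:ℝ) 1) {m : ℕ}
    {f g : (Fin (m+1) → Bool) → ℝ} (h : ∀ z, f z ≤ g z) : EM p q f ≤ EM p q g :=
  Finset.sum_le_sum fun z _ => mul_le_mul_of_nonneg_left (h z) (weight_nonneg hp hq z)

lemma EM_affine (p q : ℝ) {m : ℕ} (f : (Fin (m+1) → Bool) → ℝ) (a b : ℝ) :
    EM p q (fun z => a + b * f z) = a + b * EM p q f := by
  unfold EM
  have : ∀ z : Fin (m+1) → Bool, (1/2) * pathP (mker p q) z * (a + b * f z) =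
    a * ((1/2) * pathP (mker p q) z) + b * ((1/2) * pathP (mker p q) z * f z) := fun z => by ring
  simp_rw [this, Finset.sum_add_distrib]
  have hm := path_mass' (mker p q) (mk_sum p q) m
  rw [← Finset.mul_sum] at hm
  rw [← Finset.mul_sum, ← Finset.mul_sum, hm, mul_one, Finset.mul_sum]

lemma EM_abs {p q : ℝ} (hp : p ∈ Set.Icc (0:ℝ) 1) (hq : q ∈ Set.Icc (0:ℝ) 1) {m : ℕ}
    {f : (Fin (m+1) → Bool) → ℝ} : |EM p q f| ≤ EM p q (fun z => |f z|) := by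
  unfold EM
  refine (Finset.abs_sum_le_sum_abs _ _).trans (le_of_eq ?_)
  refine Finset.sum_congr rfl fun z _ => ?_
  rw [abs_mul, abs_of_nonneg (weight_nonneg hp hq z)]

noncomputable def M1 (p : ℝ) {m : ℕ} (z : Fin (m+1) → Bool) : ℝ :=
  transCount z false true - p * (transCount z false false + transCount z false true)
noncomputable def M2 (q : ℝ) {m : ℕ} (z : Fin (m+1) → Bool) : ℝ :=
  transCount z true false - q * (transCount z true false + transCount z true true)
noncomputable def D1 (p q : ℝ) {m : ℕ} (z : Fin (m+1) → Bool) : ℝ :=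
  transCount z true false + transCount z true true - p / (p+q) * ((m+1:ℕ):ℝ)

lemma EM_M1 {p q : ℝ} (hp : p ∈ Set.Icc (0:ℝ) 1) (hq : q ∈ Set.Icc (0:ℝ) 1) (m : ℕ) :
    EM p q (fun z : Fin (m+1) → Bool => (M1 p z)^2) ≤ m := by
  have h := path_var' (mker p q) (d1 p) (mk_nonneg hp hq) (mk_sum p q)
    (by intro a; cases a <;> simp [mker, d1]; ring)
    (by
      obtain ⟨h1, h2⟩ := hp
      intro a b; cases a <;> cases b <;> simp [d1] <;> rw [abs_le] <;> constructor <;> linarith) m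
  refine le_trans (le_of_eq ?_) h
  refine Finset.sum_congr rfl fun z _ => ?_
  rw [pathS_eq]
  simp only [d1, M1]
  ring

lemma EM_M2 {p q : ℝ} (hp : p ∈ Set.Icc (0:ℝ) 1) (hq : q ∈ Set.Icc (0:ℝ) 1) (m : ℕ) :
    EM p q (fun z : Fin (m+1) → Bool => (M2 q z)^2) ≤ m := by
  have h := path_var' (mker p q) (d2 q) (mk_nonneg hp hq) (mk_sum p q)
    (by intro a; cases a <;> simp [mker, d2]; ring)
    (by
      obtain ⟨h1, h2⟩ := hq
      intro a b; cases a <;> cases b <;> simp [d2] <;> rw [abs_le] <;> constructor <;> linarith) m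
  refine le_trans (le_of_eq ?_) h
  refine Finset.sum_congr rfl fun z _ => ?_
  rw [pathS_eq]
  simp only [d2, M2]
  ring

lemma D1_bound {p q : ℝ} (hp : p ∈ Set.Ioo (0:ℝ) 1) (hq : q ∈ Set.Ioo (0:ℝ) 1) {m : ℕ}
    (z : Fin (m+1) → Bool) :
    (D1 p q z)^2 ≤ 4 / (p+q)^2 * ((M1 p z)^2 + (M2 q z)^2 + 2) := by
  have hpq : 0 < p + q := by linarith [hp.1, hq.1]
  have h := trans_total z
  have h1 := ones_last z
  have h2 := ones_first z
  have he : ∃ e : ℝ, e^2 ≤ 1 ∧ (transCount z false true : ℝ) - transCount z true false = e := by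
    refine ⟨_, ?_, rfl⟩
    rw [h1] at h2
    have h2' := congrArg (Nat.cast : ℕ → ℝ) h2
    push_cast at h2'
    rw [sq_le_one_iff_abs_le_one, abs_le]
    constructor <;> split_ifs at h2' <;> linarith
  obtain ⟨e, he, hee⟩ := he
  have hN : (transCount z false false : ℝ) + transCount z false true + transCount z true false +
      transCount z true true = m := by exact_mod_cast h
  have key : (p+q) * D1 p q z = M1 p z - M2 q z - e - p := by
    have : (p+q) * D1 p q z = (p+q) * (transCount z true false + transCount z true true)
      - p * ((m+1:ℕ):ℝ) := by unfold D1; field_simp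
    rw [this, ← hee]
    unfold M1 M2
    push_cast
    rw [← hN]
    ring
  have hp2 : p^2 ≤ 1 := by nlinarith [hp.1, hp.2]
  rw [div_mul_eq_mul_div, le_div_iff₀ (by positivity), mul_comm, ← mul_pow, key]
  generalize M1 p z = a
  generalize M2 q z = b
  nlinarith [sq_nonneg (a+b), sq_nonneg (a+e), sq_nonneg (a+p), sq_nonneg (b-e), sq_nonneg (b-p), sq_nonneg (e-p)]

noncomputable def VV (p q : ℝ) {m : ℕ} (z : Fin (m+1) → Bool) : ℝ :=
  (D1 p q z)^2 + (M1 p z)^2 + (M2 q z)^2 + 1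

lemma EM_VV {p q : ℝ} (hp : p ∈ Set.Ioo (0:ℝ) 1) (hq : q ∈ Set.Ioo (0:ℝ) 1) :
    ∃ K : ℝ, 0 ≤ K ∧ ∀ m : ℕ, EM p q (fun z : Fin (m+1) → Bool => VV p q z) ≤ K * ((m+1:ℕ):ℝ) := by
  have hpq : 0 < p + q := by linarith [hp.1, hq.1]
  have hp' := Set.Ioo_subset_Icc_self hp
  have hq' := Set.Ioo_subset_Icc_self hq
  set c := 4 / (p+q)^2 with hc
  have hc0 : 0 ≤ c := by positivity
  refine ⟨2 * (c + 1), by positivity, fun m => ?_⟩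
  have h1 : EM p q (fun z : Fin (m+1) → Bool => VV p q z) ≤
      EM p q (fun z : Fin (m+1) → Bool => (2*c+1) + (c+1) * ((M1 p z)^2 + (M2 q z)^2)) := by
    apply EM_mono hp' hq'
    intro z
    have := D1_bound hp hq z
    unfold VV
    rw [← hc] at this
    linarith
  rw [EM_affine] at h1
  have h2 : EM p q (fun z : Fin (m+1) → Bool => (M1 p z)^2 + (M2 q z)^2) =
     EM p q (fun z : Fin (m+1) → Bool => (M1 p z)^2) + EM p q (fun z : Fin (m+1) → Bool => (M2 q z)^2) := by
    unfold EM
    rw [← Finset.sum_add_distrib]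
    exact Finset.sum_congr rfl fun z _ => by ring
  have h3 := EM_M1 hp' hq' m
  have h4 := EM_M2 hp' hq' m
  have h5 : (c+1) * EM p q (fun z : Fin (m+1) → Bool => (M1 p z)^2 + (M2 q z)^2) ≤ (c+1) * (m + m) := by
    apply mul_le_mul_of_nonneg_left _ (by positivity)
    rw [h2]; linarith
  push_cast
  nlinarith

/-- limiting value -/
noncomputable def Flim (p q : ℝ) : ℝ :=
  2 * Real.negMulLog (q/(p+q)) + 2 * Real.negMulLog (p/(p+q))
  - Real.negMulLog ((1-p)*q/(p+q)) - Real.negMulLog (p*q/(p+q))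
  - Real.negMulLog (p*q/(p+q)) - Real.negMulLog (p*(1-q)/(p+q))

lemma term_bound {C : ℝ} {ε N x l V : ℝ} (f : ℝ → ℝ) (hC : 0 ≤ C)
    (h : ∀ x ∈ Set.Icc (0:ℝ) 1, ∀ y ∈ Set.Icc (0:ℝ) 1, |f x - f y| ≤ ε + C * (x - y)^2)
    (hN : 0 < N) (hx : 0 ≤ x) (hxN : x ≤ N) (hl : 0 ≤ l) (hl1 : l ≤ 1)
    (hV : (x - l * N)^2 ≤ 4 * V) : |f (x/N) - f l| ≤ ε + 4 * C * V / N^2 := by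
  refine (h _ ⟨by positivity, by rw [div_le_one hN]; exact hxN⟩ _ ⟨hl, hl1⟩).trans ?_
  have : (x/N - l)^2 ≤ 4 * V / N^2 := by
    rw [le_div_iff₀ (by positivity), ← mul_pow]
    refine le_trans (le_of_eq ?_) hV
    congr 1
    field_simp
  have := mul_le_mul_of_nonneg_left this hC
  have e : C * (4 * V / N^2) = 4 * C * V / N^2 := by ring
  linarith

lemma lin_bound (D M M' α β γ δ : ℝ) (hα : |α| ≤ 1) (hβ : |β| ≤ 1) (hγ : |γ| ≤ 1) (hδ : |δ| ≤ 1) :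
    (α * D + β * M + γ * M' + δ)^2 ≤ 4 * (D^2 + M^2 + M'^2 + 1) := by
  have h1 : ∀ a x : ℝ, |a| ≤ 1 → (a*x)^2 ≤ x^2 := fun a x h => by
    have := (sq_le_one_iff_abs_le_one a).2 h
    rw [mul_pow]; nlinarith [sq_nonneg x]
  have a1 := h1 α D hα
  have a2 := h1 β M hβ
  have a3 := h1 γ M' hγ
  have a4 := (sq_le_one_iff_abs_le_one δ).2 hδ
  generalize α * D = x at *
  generalize β * M = y at *
  generalize γ * M' = w at *
  nlinarith [sq_nonneg (x-y), sq_nonneg (x-w), sq_nonneg (x-δ), sq_nonneg (y-w), sq_nonneg (y-δ), sq_nonneg (w-δ)]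

set_option maxHeartbeats 1600000 in
lemma Psi_sub_Flim {ε C : ℝ} (hC : 0 ≤ C)
    (h : ∀ x ∈ Set.Icc (0:ℝ) 1, ∀ y ∈ Set.Icc (0:ℝ) 1,
      |Real.negMulLog x - Real.negMulLog y| ≤ ε + C * (x - y)^2)
    {p q : ℝ} (hp : p ∈ Set.Ioo (0:ℝ) 1) (hq : q ∈ Set.Ioo (0:ℝ) 1) {m : ℕ}
    (z : Fin (m+1) → Bool) :
    |PsiN z - Flim p q| ≤ 8 * ε + (32 * C / ((m+1:ℕ):ℝ)^2) * VV p q z := by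
  obtain ⟨hp0, hp1⟩ := hp
  obtain ⟨hq0, hq1⟩ := hq
  have hpq : 0 < p + q := by linarith
  have ht := trans_total z
  have hN : (transCount z false false : ℝ) + transCount z false true + transCount z true false +
      transCount z true true + 1 = ((m+1:ℕ):ℝ) := by exact_mod_cast congrArg (· + 1) ht
  have hVV : VV p q z = (D1 p q z)^2 + (M1 p z)^2 + (M2 q z)^2 + 1 := rfl
  have hD1 : D1 p q z = transCount z true false + transCount z true true - p / (p+q) * ((m+1:ℕ):ℝ) := rfl
  have hM1 : M1 p z = transCount z false true - p * (transCount z false false + transCount z false true) := rfl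
  have hM2 : M2 q z = transCount z true false - q * (transCount z true false + transCount z true true) := rfl
  have hNpos : (0:ℝ) < ((m+1:ℕ):ℝ) := by positivity
  unfold PsiN Flim
  generalize VV p q z = V at *
  generalize D1 p q z = D at *
  generalize M1 p z = M at *
  generalize M2 q z = M' at *
  have c00 := (transCount z false false).cast_nonneg (α := ℝ)
  have c01 := (transCount z false true).cast_nonneg (α := ℝ)
  have c10 := (transCount z true false).cast_nonneg (α := ℝ)
  have c11 := (transCount z true true).cast_nonneg (α := ℝ)
  push_cast at hN hD1 hNpos ⊢
  generalize (transCount z false false : ℝ) = a at *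
  generalize (transCount z false true : ℝ) = b at *
  generalize (transCount z true false : ℝ) = c at *
  generalize (transCount z true true : ℝ) = d at *
  generalize ((m:ℝ)+1) = N at *
  have ea : p/(p+q) + q/(p+q) = 1 := by field_simp
  have hπ0 : 0 ≤ p/(p+q) := by positivity
  have hπ1 : 0 ≤ q/(p+q) := by positivity
  have e1 : (1-p)*q/(p+q) = (1-p)*(q/(p+q)) := by ring
  have e2 : p*q/(p+q) = p*(q/(p+q)) := by ring
  have e2' : p*q/(p+q) = q*(p/(p+q)) := by ring
  have e3 : p*(1-q)/(p+q) = (1-q)*(p/(p+q)) := by ring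
  have b1 : |a| = |a| := rfl
  have hab : ∀ x : ℝ, 0 ≤ x → x ≤ 1 → |x| ≤ 1 ∧ |-x| ≤ 1 := fun x h0 h1 => by
    rw [abs_neg, abs_of_nonneg h0]; exact ⟨h1, h1⟩
  have z0 := hab 0 le_rfl zero_le_one
  have z1 := hab 1 zero_le_one le_rfl
  have zp := hab p hp0.le hp1.le
  have zq := hab q hq0.le hq1.le
  have zp' := hab (1-p) (by linarith) (by linarith)
  have zq' := hab (1-q) (by linarith) (by linarith)
  set s := p/(p+q) with hs
  have et : q/(p+q) = 1 - s := by linarith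
  have t1 := term_bound (x := a + b) (l := 1 - s) (V := V) (N := N) Real.negMulLog hC h hNpos
    (by linarith) (by linarith) (by linarith) (by linarith)
    (by
      have := lin_bound D M M' (-1) 0 0 (-1) z1.2 z0.1 z0.1 z1.2
      rw [hVV]; convert this using 2
      rw [hD1, ← hN]; ring)
  have t2 := term_bound (x := c + d) (l := s) (V := V) (N := N) Real.negMulLog hC h hNpos
    (by linarith) (by linarith) (by linarith) (by linarith)
    (by
      have := lin_bound D M M' 1 0 0 0 z1.1 z0.1 z0.1 z0.1
      rw [hVV]; convert this using 2
      rw [hD1]; ring)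
  have t3 := term_bound (x := a) (l := (1-p) * (1 - s)) (V := V) (N := N) Real.negMulLog hC h hNpos
    (by linarith) (by linarith) (by nlinarith) (by nlinarith)
    (by
      have := lin_bound D M M' (-(1-p)) (-1) 0 (-(1-p)) zp'.2 z1.2 z0.1 zp'.2
      rw [hVV]; convert this using 2
      rw [hD1, hM1, ← hN]; ring)
  have t4 := term_bound (x := b) (l := p * (1 - s)) (V := V) (N := N) Real.negMulLog hC h hNpos
    (by linarith) (by linarith) (by nlinarith) (by nlinarith)
    (by
      have := lin_bound D M M' (-p) (1) 0 (-p) zp.2 z1.1 z0.1 zp.2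
      rw [hVV]; convert this using 2
      rw [hD1, hM1, ← hN]; ring)
  have t5 := term_bound (x := c) (l := q * s) (V := V) (N := N) Real.negMulLog hC h hNpos
    (by linarith) (by linarith) (by nlinarith) (by nlinarith)
    (by
      have := lin_bound D M M' q 0 1 0 zq.1 z0.1 z1.1 z0.1
      rw [hVV]; convert this using 2
      rw [hD1, hM2]; ring)
  have t6 := term_bound (x := d) (l := (1-q) * s) (V := V) (N := N) Real.negMulLog hC h hNpos
    (by linarith) (by linarith) (by nlinarith) (by nlinarith)
    (by
      have := lin_bound D M M' (1-q) 0 (-1) 0 zq'.1 z0.1 z1.2 z0.1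
      rw [hVV]; convert this using 2
      rw [hD1, hM2]; ring)
  rw [e3]
  have e2'' : Real.negMulLog (p*q/(p+q)) = Real.negMulLog (p * (1-s)) := by rw [e2, et]
  have e2''' : Real.negMulLog (p*q/(p+q)) = Real.negMulLog (q * s) := by rw [e2']
  rw [sub_eq_add_neg, e1, et]
  have hX : 32 * C / N^2 * V = 8 * (4 * C * V / N^2) := by ring
  rw [hX]
  generalize 4 * C * V / N^2 = X at *
  rw [abs_le] at *
  rw [← e2''] at t4
  rw [← e2'''] at t5
  constructor <;> linarith [t1.1, t1.2, t2.1, t2.2, t3.1, t3.2, t4.1, t4.2, t5.1, t5.2, t6.1, t6.2]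

open Filter in
lemma EM_tendsto {p q : ℝ} (hp : p ∈ Set.Ioo (0:ℝ) 1) (hq : q ∈ Set.Ioo (0:ℝ) 1) :
    Tendsto (fun m : ℕ => EM p q (fun z : Fin (m+1) → Bool => PsiN z)) atTop (nhds (Flim p q)) := by
  have hp' := Set.Ioo_subset_Icc_self hp
  have hq' := Set.Ioo_subset_Icc_self hq
  obtain ⟨K, hK, hKV⟩ := EM_VV hp hq
  rw [Metric.tendsto_atTop]
  intro ε hε
  obtain ⟨C, hC, hmod⟩ := negMulLog_modulus (ε/16) (by positivity)
  obtain ⟨n0, hn0⟩ := exists_nat_gt (32 * C * K * 2 / ε)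
  refine ⟨n0, fun m hm => ?_⟩
  have h0 : EM p q (fun z : Fin (m+1) → Bool => PsiN z) - Flim p q =
      EM p q (fun z : Fin (m+1) → Bool => -Flim p q + 1 * PsiN z) := by
    rw [EM_affine]; ring
  rw [Real.dist_eq, h0]
  have h1 := EM_abs hp' hq' (f := fun z : Fin (m+1) → Bool => -Flim p q + 1 * PsiN z)
  have h2 : EM p q (fun z : Fin (m+1) → Bool => |-Flim p q + 1 * PsiN z|) ≤
      EM p q (fun z : Fin (m+1) → Bool => 8 * (ε/16) + (32 * C / ((m+1:ℕ):ℝ)^2) * VV p q z) := by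
    apply EM_mono hp' hq'
    intro z
    have := Psi_sub_Flim hC hmod hp hq z
    refine le_trans (le_of_eq ?_) this
    congr 1; ring
  rw [EM_affine] at h2
  have hmp : (0:ℝ) < ((m+1:ℕ):ℝ) := by positivity
  have h3 : (32 * C / ((m+1:ℕ):ℝ)^2) * EM p q (fun z : Fin (m+1) → Bool => VV p q z) ≤
     (32 * C / ((m+1:ℕ):ℝ)^2) * (K * ((m+1:ℕ):ℝ)) :=
    mul_le_mul_of_nonneg_left (hKV m) (by positivity)
  have h4 : (32 * C / ((m+1:ℕ):ℝ)^2) * (K * ((m+1:ℕ):ℝ)) < ε / 2 := by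
    have : (32 * C / ((m+1:ℕ):ℝ)^2) * (K * ((m+1:ℕ):ℝ)) = 32 * C * K / ((m+1:ℕ):ℝ) := by
      field_simp
    rw [this, div_lt_iff₀ hmp]
    have hm' : (n0:ℝ) ≤ m := by exact_mod_cast hm
    rw [div_lt_iff₀ hε] at hn0
    push_cast
    nlinarith
  linarith

lemma PsiN_bound {m : ℕ} (z : Fin (m+1) → Bool) : |PsiN z| ≤ 4 := by
  have hh := trans_total z
  have key : ∀ n : ℕ, n ≤ m+1 → 0 ≤ Real.negMulLog ((n:ℝ)/((m+1:ℕ):ℝ)) ∧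
      Real.negMulLog ((n:ℝ)/((m+1:ℕ):ℝ)) ≤ 1 := by
    intro n hn
    have : (n:ℝ) ≤ ((m+1:ℕ):ℝ) := by exact_mod_cast hn
    exact ⟨Real.negMulLog_nonneg (by positivity) (by rw [div_le_one (by positivity)]; exact this),
      negMulLog_le_one (by positivity)⟩
  have k1 := key (transCount z false false + transCount z false true) (by omega)
  have k2 := key (transCount z true false + transCount z true true) (by omega)
  have k3 := key (transCount z false false) (by omega)
  have k4 := key (transCount z false true) (by omega)
  have k5 := key (transCount z true false) (by omega)
  have k6 := key (transCount z true true) (by omega)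
  unfold PsiN
  rw [abs_le]
  constructor <;> linarith [k1.1, k1.2, k2.1, k2.2, k3.1, k3.2, k4.1, k4.2, k5.1, k5.2, k6.1, k6.2]
open Finset

lemma pathP_mker_cont {m : ℕ} (z : Fin (m+1) → Bool) :
    Continuous (fun x : ℝ × ℝ => pathP (mker x.1 x.2) z) := by
  simp_rw [pathP_eq]
  simp only [mker]
  fun_prop

lemma EM_cont {m : ℕ} (f : (Fin (m+1) → Bool) → ℝ) :
    Continuous (fun x : ℝ × ℝ => EM x.1 x.2 f) := by
  unfold EM
  have := fun z : Fin (m+1) → Bool => pathP_mker_cont z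
  fun_prop

lemma Q_eq {m : ℕ} (z : Fin (m+1) → Bool) :
    QummSingle z = ∫ p in (0:ℝ)..1, ∫ q in (0:ℝ)..1, (1/2) * pathP (mker p q) z := by
  unfold QummSingle
  simp_rw [intervalIntegral.integral_const_mul, pathP_eq]
  simp only [mker]

lemma Q_sum {m : ℕ} (f : (Fin (m+1) → Bool) → ℝ) :
    ∑ z, QummSingle z * f z = ∫ p in (0:ℝ)..1, ∫ q in (0:ℝ)..1, EM p q f := by
  unfold EM
  have h1 : ∀ p : ℝ, ∫ q in (0:ℝ)..1, ∑ z : Fin (m+1) → Bool, (1/2) * pathP (mker p q) z * f z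
      = ∑ z : Fin (m+1) → Bool, (∫ q in (0:ℝ)..1, (1/2) * pathP (mker p q) z) * f z := by
    intro p
    rw [intervalIntegral.integral_finsetSum]
    · simp_rw [intervalIntegral.integral_mul_const]
    · intro z _
      apply Continuous.intervalIntegrable
      have := (pathP_mker_cont z).comp (Continuous.prodMk_right p)
      simp only [Function.comp_def] at this
      fun_prop
  simp_rw [h1]
  rw [intervalIntegral.integral_finsetSum]
  · simp_rw [intervalIntegral.integral_mul_const, Q_eq]
  · intro z _
    apply Continuous.intervalIntegrable
    apply Continuous.mul _ continuous_const
    apply intervalIntegral.continuous_parametric_intervalIntegral_of_continuous'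
    have := pathP_mker_cont z
    simp only [Function.uncurry_def]
    fun_prop

lemma Q_mass (m : ℕ) : ∑ z : Fin (m+1) → Bool, QummSingle z = 1 := by
  have := Q_sum (fun _ : Fin (m+1) → Bool => (1:ℝ))
  simp only [mul_one] at this
  rw [this]
  have h : ∀ p q : ℝ, EM p q (fun _ : Fin (m+1) → Bool => (1:ℝ)) = 1 := by
    intro p q
    have := EM_affine p q (fun _ : Fin (m+1) → Bool => (1:ℝ)) 1 0
    simpa using this
  simp [h]

lemma Q_pos {m : ℕ} (z : Fin (m+1) → Bool) : 0 < QummSingle z := by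
  have hpos : ∀ p ∈ Set.Ioo (0:ℝ) 1, ∀ q ∈ Set.Ioo (0:ℝ) 1, 0 < (1/2) * pathP (mker p q) z := by
    intro p hp q hq
    rw [pathP_eq]
    simp only [mker]
    have h1 := hp.1
    have h2 := hq.1
    have h3 : 0 < 1 - p := by linarith [hp.2]
    have h4 : 0 < 1 - q := by linarith [hq.2]
    positivity
  rw [Q_eq]
  apply intervalIntegral.intervalIntegral_pos_of_pos_on
  · apply Continuous.intervalIntegrable
    apply intervalIntegral.continuous_parametric_intervalIntegral_of_continuous'
    have := pathP_mker_cont z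
    simp only [Function.uncurry_def]
    fun_prop
  · intro p hp
    apply intervalIntegral.intervalIntegral_pos_of_pos_on
    · apply Continuous.intervalIntegrable
      have := (pathP_mker_cont z).comp (Continuous.prodMk_right p)
      simp only [Function.comp_def] at this
      fun_prop
    · exact hpos p hp
    · norm_num
  · norm_num

lemma EM_PsiN_bound {p q : ℝ} (hp : p ∈ Set.Icc (0:ℝ) 1) (hq : q ∈ Set.Icc (0:ℝ) 1) (m : ℕ) :
    |EM p q (fun z : Fin (m+1) → Bool => PsiN z)| ≤ 4 := by
  refine (EM_abs hp hq).trans ?_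
  refine (EM_mono hp hq (g := fun z => 4 + 0 * PsiN z) (fun z => ?_)).trans ?_
  · simpa using PsiN_bound z
  · rw [EM_affine]; simp

lemma ae_ne_one : ∀ᵐ x : ℝ ∂MeasureTheory.volume, x ≠ 1 := by
  simp [MeasureTheory.ae_iff]

lemma mem_Ioo_of {x : ℝ} (hx : x ∈ Set.uIoc (0:ℝ) 1) (h : x ≠ 1) : x ∈ Set.Ioo (0:ℝ) 1 := by
  rw [Set.uIoc_of_le zero_le_one] at hx
  exact ⟨hx.1, lt_of_le_of_ne hx.2 h⟩

open Filter in
lemma Psi_tendsto :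
    Tendsto (fun m : ℕ => ∑ z : Fin (m+1) → Bool, QummSingle z * PsiN z) atTop
      (nhds (∫ p in (0:ℝ)..1, ∫ q in (0:ℝ)..1, Flim p q)) := by
  simp_rw [Q_sum]
  have hin : ∀ p ∈ Set.Ioo (0:ℝ) 1, Tendsto (fun m : ℕ => ∫ q in (0:ℝ)..1,
      EM p q (fun z : Fin (m+1) → Bool => PsiN z)) atTop (nhds (∫ q in (0:ℝ)..1, Flim p q)) := by
    intro p hp
    apply intervalIntegral.tendsto_integral_filter_of_dominated_convergence (fun _ => (4:ℝ))
    · refine Eventually.of_forall fun m => ?_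
      exact ((EM_cont _).comp (Continuous.prodMk_right p)).aestronglyMeasurable
    · refine Eventually.of_forall fun m => ?_
      filter_upwards [ae_ne_one] with q hq1 hq
      exact EM_PsiN_bound (Set.Ioo_subset_Icc_self hp) (Set.Ioo_subset_Icc_self (mem_Ioo_of hq hq1)) m
    · simp
    · filter_upwards [ae_ne_one] with q hq1 hq
      exact EM_tendsto hp (mem_Ioo_of hq hq1)
  apply intervalIntegral.tendsto_integral_filter_of_dominated_convergence (fun _ => (4:ℝ))
  · refine Eventually.of_forall fun m => ?_
    refine Continuous.aestronglyMeasurable ?_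
    apply intervalIntegral.continuous_parametric_intervalIntegral_of_continuous'
    exact EM_cont _
  · refine Eventually.of_forall fun m => ?_
    filter_upwards [ae_ne_one] with p hp1 hp
    have hp2 := mem_Ioo_of hp hp1
    have := intervalIntegral.norm_integral_le_of_norm_le_const (a := 0) (b := 1) (C := 4)
      (f := fun q => EM p q (fun z : Fin (m+1) → Bool => PsiN z)) (fun q hq => by
        rw [Set.uIoc_of_le zero_le_one] at hq
        exact EM_PsiN_bound (Set.Ioo_subset_Icc_self hp2) ⟨hq.1.le, hq.2⟩ m)
    simpa using this
  · simp
  · filter_upwards [ae_ne_one] with p hp1 hp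
    exact hin p (mem_Ioo_of hp hp1)

open Filter in
lemma logN_tendsto (K : ℝ) :
    Tendsto (fun m : ℕ => K * (1 + Real.log (((m+1:ℕ):ℝ)+1)) / ((m+1:ℕ):ℝ)) atTop (nhds 0) := by
  have h1 : Tendsto (fun x : ℝ => Real.log x / x) atTop (nhds 0) := by
    have := Real.isLittleO_log_id_atTop.tendsto_div_nhds_zero
    simpa using this
  have hnat : Tendsto (fun m : ℕ => ((m+1:ℕ):ℝ)) atTop atTop :=
    tendsto_natCast_atTop_atTop.comp (tendsto_add_atTop_nat 1)
  have h2 := h1.comp (tendsto_atTop_add_const_right _ (1:ℝ) hnat)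
  have h3 : Tendsto (fun m : ℕ => (1:ℝ) / ((m+1:ℕ):ℝ)) atTop (nhds 0) := hnat.const_div_atTop 1
  have h4 := ((h2.mul (h3.const_add 1)).add h3).const_mul K
  simp only [add_zero, zero_mul, mul_zero] at h4
  refine h4.congr fun m => ?_
  have : (0:ℝ) < ((m+1:ℕ):ℝ) := by positivity
  simp only [Function.comp]
  field_simp
  ring

open Filter in
lemma ELB_tendsto :
    Tendsto (fun m : ℕ => (1 / ((m+1:ℕ):ℝ)) * ∑ z : Fin (m+1) → Bool, QummSingle z * Real.log (ELB z))
      atTop (nhds (∫ p in (0:ℝ)..1, ∫ q in (0:ℝ)..1, Flim p q)) := by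
  refine tendsto_of_tendsto_of_dist Psi_tendsto ?_
  refine squeeze_zero (fun _ => dist_nonneg) (fun m => ?_) (logN_tendsto 20)
  have hN : (0:ℝ) < ((m+1:ℕ):ℝ) := by positivity
  rw [dist_comm, Real.dist_eq]
  have : (1 / ((m+1:ℕ):ℝ)) * ∑ z : Fin (m+1) → Bool, QummSingle z * Real.log (ELB z) -
      ∑ z : Fin (m+1) → Bool, QummSingle z * PsiN z = (∑ z : Fin (m+1) → Bool, QummSingle z *
      (Real.log (ELB z) - ((m+1:ℕ):ℝ) * PsiN z)) / ((m+1:ℕ):ℝ) := by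
    simp_rw [mul_sub, Finset.sum_sub_distrib, mul_left_comm _ ((m+1:ℕ):ℝ), ← Finset.mul_sum]
    field_simp
  rw [this, abs_div, abs_of_pos hN]
  gcongr
  calc _ ≤ ∑ z : Fin (m+1) → Bool, |QummSingle z * (Real.log (ELB z) - ((m+1:ℕ):ℝ) * PsiN z)| :=
        Finset.abs_sum_le_sum_abs _ _
    _ ≤ ∑ z : Fin (m+1) → Bool, QummSingle z * (20 * (1 + Real.log (((m+1 : ℕ):ℝ)+1))) := by
        refine Finset.sum_le_sum fun z _ => ?_
        rw [abs_mul, abs_of_pos (Q_pos z)]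
        exact mul_le_mul_of_nonneg_left (ELB_approx z) (Q_pos z).le
    _ = _ := by rw [← Finset.sum_mul, Q_mass, one_mul]

lemma onesCount_le {N : ℕ} (z : Fin N → Bool) : onesCount z ≤ N := by
  unfold onesCount
  exact (Finset.card_le_univ _).trans (by simp)

lemma level_nonneg (m k : ℕ) : 0 ≤ QummLevel (m+1) k :=
  Finset.sum_nonneg fun z _ => (Q_pos z).le

lemma level_sum (m : ℕ) (f : ℕ → ℝ) :
    ∑ z : Fin (m+1) → Bool, QummSingle z * f (onesCount z) =
      ∑ k ∈ Finset.range (m+2), QummLevel (m+1) k * f k := by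
  rw [← Finset.sum_fiberwise_of_maps_to (s := Finset.univ) (t := Finset.range (m+2))
    (g := fun z : Fin (m+1) → Bool => onesCount z)
    (fun z _ => by rw [Finset.mem_range]; have := onesCount_le z; omega)]
  refine Finset.sum_congr rfl fun k _ => ?_
  unfold QummLevel
  rw [Finset.sum_mul]
  refine Finset.sum_congr rfl fun z hz => ?_
  rw [(Finset.mem_filter.1 hz).2]

lemma negMulLog_ub {w n : ℝ} (hw : 0 ≤ w) (hn : 0 < n) :
    Real.negMulLog w ≤ w * Real.log n + 1/n - w := by
  rcases hw.eq_or_lt with h | h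
  · subst h; simp; exact hn.le
  have := Real.log_le_sub_one_of_pos (show 0 < (n*w)⁻¹ by positivity)
  rw [Real.log_inv, Real.log_mul hn.ne' h.ne'] at this
  have h2 := mul_le_mul_of_nonneg_left this hw
  have e : w * ((n*w)⁻¹ - 1) = 1/n - w := by field_simp
  rw [e] at h2
  unfold Real.negMulLog
  linarith

lemma level_entropy (m : ℕ) :
    |∑ z : Fin (m+1) → Bool, QummSingle z * Real.log (QummLevel (m+1) (onesCount z))| ≤
      1 + Real.log (((m+1:ℕ):ℝ)+1) := by
  rw [level_sum m (fun k => Real.log (QummLevel (m+1) k))]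
  have hs : ∑ k ∈ Finset.range (m+2), QummLevel (m+1) k = 1 := by
    have := level_sum m (fun _ => 1)
    simp only [mul_one, Q_mass] at this
    exact this.symm
  have hle : ∀ k ∈ Finset.range (m+2), QummLevel (m+1) k ≤ 1 := by
    intro k hk
    rw [← hs]
    exact Finset.single_le_sum (fun i _ => level_nonneg m i) hk
  have h1 : ∑ k ∈ Finset.range (m+2), QummLevel (m+1) k * Real.log (QummLevel (m+1) k) =
      - ∑ k ∈ Finset.range (m+2), Real.negMulLog (QummLevel (m+1) k) := by
    rw [← Finset.sum_neg_distrib]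
    exact Finset.sum_congr rfl fun k _ => by unfold Real.negMulLog; ring
  rw [h1, abs_neg, abs_of_nonneg (Finset.sum_nonneg fun k hk =>
    Real.negMulLog_nonneg (level_nonneg m k) (hle k hk))]
  have hn : (0:ℝ) < ((m+1:ℕ):ℝ)+1 := by positivity
  calc _ ≤ ∑ k ∈ Finset.range (m+2), (QummLevel (m+1) k * Real.log (((m+1:ℕ):ℝ)+1) +
        1/(((m+1:ℕ):ℝ)+1) - QummLevel (m+1) k) :=
        Finset.sum_le_sum fun k _ => negMulLog_ub (level_nonneg m k) hn
    _ = Real.log (((m+1:ℕ):ℝ)+1) := by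
        rw [Finset.sum_sub_distrib, Finset.sum_add_distrib, ← Finset.sum_mul, hs]
        simp only [Finset.sum_const, Finset.card_range, nsmul_eq_mul]
        push_cast
        field_simp
        ring
    _ ≤ _ := by linarith

open Filter in
lemma UMM_tendsto :
    Tendsto (fun m : ℕ => (1 / ((m+1:ℕ):ℝ)) * ∑ z : Fin (m+1) → Bool, QummSingle z * Real.log (UMM z))
      atTop (nhds (∫ p in (0:ℝ)..1, ∫ q in (0:ℝ)..1, Flim p q)) := by
  refine tendsto_of_tendsto_of_dist ELB_tendsto ?_
  refine squeeze_zero (fun _ => dist_nonneg) (fun m => ?_) (logN_tendsto 1)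
  have hN : (0:ℝ) < ((m+1:ℕ):ℝ) := by positivity
  have hL : ∀ z : Fin (m+1) → Bool, 0 < QummLevel (m+1) (onesCount z) := fun z =>
    Finset.sum_pos (fun z _ => Q_pos z) ⟨z, by simp⟩
  have h : ∀ z : Fin (m+1) → Bool, Real.log (UMM z) = Real.log (ELB z) -
      Real.log (QummLevel (m+1) (onesCount z)) := fun z =>
    Real.log_div (ELB_pos z).ne' (hL z).ne'
  rw [Real.dist_eq]
  simp_rw [h, mul_sub, Finset.sum_sub_distrib]
  rw [mul_sub, sub_sub_cancel, abs_mul, abs_of_pos (by positivity), one_mul, one_div,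
    inv_mul_eq_div]
  gcongr
  exact level_entropy m
open Finset

lemma int_pow_log (n : ℕ) : ∫ x in (0:ℝ)..1, -Real.log x * x^n = 1/((n:ℝ)+1)^2 := by
  have h := intervalIntegral.integral_eq_sub_of_hasDerivAt_of_le (a := (0:ℝ)) (b := 1)
    (f := fun x : ℝ => x^n * (-(x * Real.log x)) / (n+1) + x^(n+1)/((n:ℝ)+1)^2)
    (f' := fun x => -Real.log x * x^n) zero_le_one ?_ ?_ ?_
  · rw [h]; simp
  · have := Real.continuous_mul_log
    fun_prop
  · intro x hx
    have hx0 : x ≠ 0 := hx.1.ne'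
    have h1 := ((hasDerivAt_pow (n+1) x).mul (Real.hasDerivAt_log hx0)).neg.div_const ((n:ℝ)+1)
    have h2 := (hasDerivAt_pow (n+1) x).div_const (((n:ℝ)+1)^2)
    have h3 := h1.add h2
    refine (h3.congr_deriv ?_).congr_of_eventuallyEq ?_
    · simp only [Nat.add_sub_cancel]
      push_cast
      field_simp
      ring
    · refine Filter.Eventually.of_forall fun y => ?_
      simp [pow_succ]
      ring
  · exact (intervalIntegral.intervalIntegrable_log').neg.mul_continuousOn (by fun_prop)

lemma A1_integrable : IntervalIntegrable (fun x : ℝ => Real.log x / (1-x)) MeasureTheory.volume 0 1 := by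
  have hb : IntervalIntegrable (fun x : ℝ => -Real.log x + 1) MeasureTheory.volume 0 1 :=
    (intervalIntegral.intervalIntegrable_log').neg.add (by simp)
  refine hb.mono_fun' ?_ ?_
  · exact (Measurable.div Real.measurable_log (by fun_prop)).aestronglyMeasurable
  · rw [Filter.EventuallyLE, MeasureTheory.ae_restrict_iff' measurableSet_uIoc]
    refine Filter.Eventually.of_forall fun x hx => ?_
    rw [Set.uIoc_of_le zero_le_one] at hx
    rcases hx.2.eq_or_lt with h | h
    · subst h; simp
    have h1 : 0 < 1 - x := by linarith
    have hl : Real.log x ≤ 0 := Real.log_nonpos hx.1.le hx.2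
    rw [Real.norm_eq_abs, abs_div, abs_of_nonpos hl, abs_of_pos h1, div_le_iff₀ h1]
    have h2 := Real.one_sub_inv_le_log_of_pos hx.1
    have h3 := mul_le_mul_of_nonneg_left h2 hx.1.le
    rw [mul_sub, mul_inv_cancel₀ hx.1.ne'] at h3
    nlinarith

lemma A1_val : ∫ x in (0:ℝ)..1, Real.log x / (1-x) = -(Real.pi^2/6) := by
  have hi : ∀ n : ℕ, IntervalIntegrable (fun x : ℝ => -Real.log x * x^n) MeasureTheory.volume 0 1 :=
    fun n => (intervalIntegral.intervalIntegrable_log').neg.mul_continuousOn (by fun_prop)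
  have hz : HasSum (fun n : ℕ => 1/((n:ℝ)+1)^2) (Real.pi^2/6) := by
    have := (hasSum_nat_add_iff' 1).2 hasSum_zeta_two
    simpa using this
  have hn : ∀ n : ℕ, ∫ x in Set.Ioc (0:ℝ) 1, ‖-Real.log x * x^n‖ = 1/((n:ℝ)+1)^2 := by
    intro n
    rw [← int_pow_log, intervalIntegral.integral_of_le zero_le_one]
    refine MeasureTheory.setIntegral_congr_fun measurableSet_Ioc fun x hx => ?_
    rw [Real.norm_of_nonneg]
    have := Real.log_nonpos hx.1.le hx.2
    have := pow_nonneg hx.1.le n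
    nlinarith
  have h := MeasureTheory.hasSum_integral_of_summable_integral_norm
    (μ := MeasureTheory.volume.restrict (Set.Ioc (0:ℝ) 1)) (F := fun (n:ℕ) (x:ℝ) => -Real.log x * x^n)
    (fun n => (hi n).1) (by simp_rw [hn]; exact hz.summable)
  have h' : ∀ n : ℕ, ∫ x in Set.Ioc (0:ℝ) 1, -Real.log x * x^n = 1/((n:ℝ)+1)^2 := by
    intro n
    rw [← int_pow_log, intervalIntegral.integral_of_le zero_le_one]
  simp_rw [h'] at h
  rw [hz.unique h, ← MeasureTheory.integral_neg, intervalIntegral.integral_of_le zero_le_one]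
  refine MeasureTheory.setIntegral_congr_fun measurableSet_Ioc fun x hx => ?_
  rcases hx.2.eq_or_lt with h | h
  · subst h; simp
  rw [tsum_mul_left, tsum_geometric_of_lt_one hx.1.le h]
  ring

lemma A2_integrable : IntervalIntegrable (fun x : ℝ => Real.log x / (1+x)) MeasureTheory.volume 0 1 := by
  simp_rw [div_eq_mul_inv]
  apply (intervalIntegral.intervalIntegrable_log').mul_continuousOn
  apply ContinuousOn.inv₀ (by fun_prop)
  intro x hx
  rw [Set.uIcc_of_le zero_le_one] at hx
  linarith [hx.1]

lemma A3_integrable : IntervalIntegrable (fun x : ℝ => Real.log (1-x) / (1+x)) MeasureTheory.volume 0 1 := by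
  simp_rw [div_eq_mul_inv]
  apply IntervalIntegrable.mul_continuousOn
  · have := (intervalIntegral.intervalIntegrable_log' (a := 0) (b := 1)).comp_sub_left 1
    simpa using this.symm
  apply ContinuousOn.inv₀ (by fun_prop)
  intro x hx
  rw [Set.uIcc_of_le zero_le_one] at hx
  linarith [hx.1]

lemma A2_val : ∫ x in (0:ℝ)..1, Real.log x / (1+x) = -(Real.pi^2/12) := by
  have hpt : ∀ x ∈ Set.Icc (0:ℝ) 1, ((fun u : ℝ => Real.log u / (1-u)) ∘ (fun x => x^2)) x * (2*x) =
      2 * (Real.log x / (1-x) - Real.log x / (1+x)) := by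
    intro x hx
    simp only [Function.comp]
    rcases hx.2.eq_or_lt with h | h
    · subst h; simp
    have h1 : 1 - x ≠ 0 := by linarith
    have h2 : 1 + x ≠ 0 := by linarith [hx.1]
    have h3 : 1 - x^2 = (1-x)*(1+x) := by ring
    rw [Real.log_pow, h3]
    push_cast
    field_simp
    ring
  have h := intervalIntegral.integral_comp_mul_deriv''' (a := 0) (b := 1) (f := fun x : ℝ => x^2)
    (f' := fun x => 2*x) (g := fun u : ℝ => Real.log u / (1-u)) (by fun_prop) ?_ ?_ ?_ ?_
  · rw [intervalIntegral.integral_congr (g := fun x =>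
      2 * (Real.log x / (1-x) - Real.log x / (1+x))) (by rw [Set.uIcc_of_le zero_le_one]; exact hpt)] at h
    rw [intervalIntegral.integral_const_mul, intervalIntegral.integral_sub A1_integrable A2_integrable] at h
    norm_num at h
    rw [A1_val] at h
    linarith
  · intro x _
    have := (hasDerivAt_pow 2 x).hasDerivWithinAt (s := Set.Ioi x)
    simpa using this
  · simp only [min_eq_left, max_eq_right, zero_le_one]
    rintro y ⟨x, hx, rfl⟩
    have h1 : x^2 ≠ 0 := by have := hx.1; positivity
    have h2 : 1 - x^2 ≠ 0 := by nlinarith [hx.1, hx.2]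
    apply ContinuousAt.continuousWithinAt
    exact (Real.continuousAt_log h1).div (by fun_prop) h2
  · have : (fun x : ℝ => x^2) '' Set.uIcc 0 1 ⊆ Set.Icc 0 1 := by
      rw [Set.uIcc_of_le zero_le_one]
      rintro y ⟨x, hx, rfl⟩
      exact ⟨by positivity, by nlinarith [hx.1, hx.2]⟩
    refine MeasureTheory.IntegrableOn.mono_set ?_ this
    exact (intervalIntegrable_iff_integrableOn_Icc_of_le zero_le_one).1 A1_integrable
  · rw [Set.uIcc_of_le zero_le_one]
    refine MeasureTheory.IntegrableOn.congr_fun (f := fun x => 2 * (Real.log x / (1-x) - Real.log x / (1+x))) ?_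
      (fun x hx => (hpt x hx).symm) measurableSet_Icc
    exact (intervalIntegrable_iff_integrableOn_Icc_of_le zero_le_one).1
      ((A1_integrable.sub A2_integrable).const_mul 2)

lemma elem_cont : ContinuousOn (fun t : ℝ => (Real.log 2 - Real.log (1+t)) / (1+t)) (Set.uIcc 0 1) := by
  intro x hx
  rw [Set.uIcc_of_le zero_le_one] at hx
  have h1 : 1 + x ≠ 0 := by linarith [hx.1]
  apply ContinuousAt.continuousWithinAt
  have : ContinuousAt (fun t : ℝ => Real.log (1+t)) x :=
    ContinuousAt.log (by fun_prop) h1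
  exact (continuousAt_const.sub this).div (by fun_prop) h1

lemma elem_val : ∫ t in (0:ℝ)..1, (Real.log 2 - Real.log (1+t)) / (1+t) = (Real.log 2)^2/2 := by
  have h := intervalIntegral.integral_eq_sub_of_hasDerivAt (a := 0) (b := 1)
    (f := fun t : ℝ => Real.log 2 * Real.log (1+t) - (Real.log (1+t))^2/2)
    (f' := fun t => (Real.log 2 - Real.log (1+t)) / (1+t)) ?_ elem_cont.intervalIntegrable
  · rw [h]; norm_num; ring
  · intro x hx
    rw [Set.uIcc_of_le zero_le_one] at hx
    have h1 : 1 + x ≠ 0 := by linarith [hx.1]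
    have hl : HasDerivAt (fun t : ℝ => Real.log (1+t)) (1/(1+x)) x :=
      ((hasDerivAt_id x).const_add 1).log h1
    refine ((hl.const_mul (Real.log 2)).sub ((hl.pow 2).div_const 2)).congr_deriv ?_
    simp
    field_simp

lemma A3_val : ∫ x in (0:ℝ)..1, Real.log (1-x) / (1+x) = (Real.log 2)^2/2 - Real.pi^2/12 := by
  have hpt : ∀ t ∈ Set.Ioc (0:ℝ) 1, ((fun x : ℝ => Real.log (1-x) / (1+x)) ∘ (fun t => (1-t)/(1+t))) t *
      (-2/(1+t)^2) =
      - ((Real.log 2 - Real.log (1+t)) / (1+t) + Real.log t / (1+t)) := by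
    intro t ht
    simp only [Function.comp]
    have h0 := ht.1
    have h2 : 0 < 1 + t := by linarith [ht.1]
    have e1 : 1 - (1-t)/(1+t) = 2*t/(1+t) := by field_simp; ring
    have e2 : 1 + (1-t)/(1+t) = 2/(1+t) := by field_simp; ring
    rw [e1, e2, Real.log_div (by positivity) h2.ne', Real.log_mul (by norm_num) h0.ne']
    field_simp
    ring
  have hpt0 : Set.EqOn (fun t => ((fun x : ℝ => Real.log (1-x) / (1+x)) ∘ (fun t => (1-t)/(1+t))) t *
      (-2/(1+t)^2)) (fun t => - ((Real.log 2 - Real.log (1+t)) / (1+t) + Real.log t / (1+t)))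
      (Set.Ioc 0 1) := hpt
  have hIntg : IntervalIntegrable (fun t : ℝ => - ((Real.log 2 - Real.log (1+t)) / (1+t) + Real.log t / (1+t)))
    MeasureTheory.volume 0 1 := (elem_cont.intervalIntegrable.add A2_integrable).neg
  have h := intervalIntegral.integral_comp_mul_deriv''' (a := 0) (b := 1) (f := fun t : ℝ => (1-t)/(1+t))
    (f' := fun t => -2/(1+t)^2) (g := fun x : ℝ => Real.log (1-x) / (1+x)) ?_ ?_ ?_ ?_ ?_
  · rw [intervalIntegral.integral_congr_ae (g := fun t =>
      - ((Real.log 2 - Real.log (1+t)) / (1+t) + Real.log t / (1+t)))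
      (by rw [Set.uIoc_of_le zero_le_one]; exact Filter.Eventually.of_forall hpt)] at h
    rw [intervalIntegral.integral_neg, intervalIntegral.integral_add elem_cont.intervalIntegrable
      A2_integrable, elem_val, A2_val] at h
    norm_num at h
    rw [intervalIntegral.integral_symm] at h
    linarith
  · apply ContinuousOn.div (by fun_prop) (by fun_prop)
    intro x hx
    rw [Set.uIcc_of_le zero_le_one] at hx
    linarith [hx.1]
  · intro x hx
    simp only [min_eq_left, zero_le_one] at hx
    have h1 : 1 + x ≠ 0 := by linarith [hx.1]
    refine HasDerivAt.hasDerivWithinAt ?_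
    refine (((hasDerivAt_id x).const_sub 1).div ((hasDerivAt_id x).const_add 1) h1).congr_deriv ?_
    simp
    field_simp
    ring
  · simp only [min_eq_left, max_eq_right, zero_le_one]
    rintro y ⟨x, hx, rfl⟩
    have h0 := hx.1
    have h0' := hx.2
    have h2 : 0 < 1 + x := by linarith
    have e1 : 1 - (1-x)/(1+x) ≠ 0 := by
      have : 1 - (1-x)/(1+x) = 2*x/(1+x) := by field_simp; ring
      rw [this]; positivity
    have e2 : 1 + (1-x)/(1+x) ≠ 0 := by
      have : 1 + (1-x)/(1+x) = 2/(1+x) := by field_simp; ring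
      rw [this]; positivity
    apply ContinuousAt.continuousWithinAt
    exact (ContinuousAt.log (by fun_prop) e1).div (by fun_prop) e2
  · have : (fun t : ℝ => (1-t)/(1+t)) '' Set.uIcc 0 1 ⊆ Set.Icc 0 1 := by
      rw [Set.uIcc_of_le zero_le_one]
      rintro y ⟨x, hx, rfl⟩
      have h0 := hx.1
      have h0' := hx.2
      have h2 : 0 < 1 + x := by linarith
      exact ⟨div_nonneg (by linarith) h2.le, by simp only; rw [div_le_one h2]; linarith⟩
    refine MeasureTheory.IntegrableOn.mono_set ?_ this
    exact (intervalIntegrable_iff_integrableOn_Icc_of_le zero_le_one).1 A3_integrable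
  · rw [Set.uIcc_of_le zero_le_one, integrableOn_Icc_iff_integrableOn_Ioc]
    exact MeasureTheory.IntegrableOn.congr_fun
      ((intervalIntegrable_iff_integrableOn_Ioc_of_le zero_le_one).1 hIntg) hpt0.symm measurableSet_Ioc
open Finset

noncomputable def Hbin (p : ℝ) : ℝ := Real.negMulLog p + Real.negMulLog (1-p)

noncomputable def gfun (p q : ℝ) : ℝ := Real.negMulLog (p/(p+q)) - q/(p+q) * Hbin p

lemma Flim_eq {p q : ℝ} (hp : 0 < p) (hq : 0 < q) : Flim p q = gfun p q + gfun q p := by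
  unfold Flim gfun Hbin
  have hs : p + q ≠ 0 := by positivity
  rw [mul_div_assoc (1-p), mul_div_assoc p q, mul_comm p (1-q), mul_div_assoc (1-q),
    Real.negMulLog_mul (1-p), Real.negMulLog_mul p (q/(p+q)), Real.negMulLog_mul (1-q), add_comm q p]
  have h2 : Real.negMulLog (p * (q/(p+q))) = Real.negMulLog (q * (p/(p+q))) := by
    congr 1; field_simp
  have h3 := h2
  rw [Real.negMulLog_mul p (q/(p+q)), Real.negMulLog_mul q (p/(p+q))] at h3
  linear_combination -h3

lemma Hbin_nonneg {p : ℝ} (hp : p ∈ Set.Ioc (0:ℝ) 1) : 0 ≤ Hbin p :=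
  add_nonneg (Real.negMulLog_nonneg hp.1.le hp.2)
    (Real.negMulLog_nonneg (by linarith [hp.2]) (by linarith [hp.1]))

lemma gfun_integrable : MeasureTheory.IntegrableOn (Function.uncurry gfun)
    (Set.uIoc (0:ℝ) 1 ×ˢ Set.uIoc (0:ℝ) 1) := by
  have hm : Measurable (Function.uncurry gfun) := by
    unfold Function.uncurry gfun Hbin
    have := Real.continuous_negMulLog.measurable
    fun_prop
  refine MeasureTheory.Measure.integrableOn_of_bounded (M := 3) ?_ hm.aestronglyMeasurable ?_
  · rw [MeasureTheory.Measure.volume_eq_prod, MeasureTheory.Measure.prod_prod]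
    simp
  · refine (MeasureTheory.ae_restrict_iff' (measurableSet_uIoc.prod measurableSet_uIoc)).2
      (Filter.Eventually.of_forall ?_)
    rintro ⟨p, q⟩ ⟨hp, hq⟩
    rw [Set.uIoc_of_le zero_le_one] at hp hq
    simp only at hp hq
    have hs : 0 < p + q := add_pos hp.1 hq.1
    have hy0 : 0 ≤ p/(p+q) := (div_pos hp.1 hs).le
    have hy1 : p/(p+q) ≤ 1 := (div_le_one hs).2 (by linarith [hq.1])
    have hx0 : 0 ≤ q/(p+q) := (div_pos hq.1 hs).le
    have hx1 : q/(p+q) ≤ 1 := (div_le_one hs).2 (by linarith [hp.1])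
    have h1 := Real.negMulLog_nonneg hy0 hy1
    have h2 := negMulLog_le_one hy0
    have h3 := Hbin_nonneg hp
    have h4 : Hbin p ≤ 2 := by
      have := negMulLog_le_one hp.1.le
      have := negMulLog_le_one (x := 1-p) (by linarith [hp.2])
      unfold Hbin; linarith
    have h5 : 0 ≤ q/(p+q) * Hbin p := mul_nonneg hx0 h3
    have h6 : q/(p+q) * Hbin p ≤ 1 * 2 := mul_le_mul hx1 h4 h3 zero_le_one
    simp only [Function.uncurry_apply_pair, gfun, Real.norm_eq_abs, abs_le]
    constructor <;> linarith

lemma gfun_inner {p : ℝ} (hp : p ∈ Set.Ioc (0:ℝ) 1) :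
    ∫ q in (0:ℝ)..1, gfun p q = p/2*(Real.log (1+p) - Real.log p)^2
      - Hbin p * (1 - p*(Real.log (1+p) - Real.log p)) := by
  have hd : ∀ q ∈ Set.uIcc (0:ℝ) 1, HasDerivAt (fun q => p/2*(Real.log (p+q) - Real.log p)^2
      - Hbin p * (q - p*Real.log (p+q))) (gfun p q) q := by
    intro q hq
    rw [Set.uIcc_of_le zero_le_one] at hq
    have hs : 0 < p + q := by linarith [hp.1, hq.1]
    have h1 : HasDerivAt (fun q => Real.log (p+q)) (1/(p+q)) q :=
      ((hasDerivAt_id q).const_add p).log hs.ne'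
    have := ((((h1.sub_const (Real.log p)).pow 2).const_mul (p/2))).sub
      (((hasDerivAt_id q).sub (h1.const_mul p)).const_mul (Hbin p))
    refine this.congr_deriv ?_
    unfold gfun Real.negMulLog
    rw [Real.log_div hp.1.ne' hs.ne']
    push_cast
    field_simp
    ring
  rw [intervalIntegral.integral_eq_sub_of_hasDerivAt hd]
  · simp only [add_zero, add_comm p 1]; ring
  · apply ContinuousOn.intervalIntegrable
    rw [Set.uIcc_of_le zero_le_one]
    have h := Real.continuous_negMulLog
    have hne : ∀ q ∈ Set.Icc (0:ℝ) 1, p + q ≠ 0 := fun q hq => by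
      have := hp.1; have := hq.1; positivity
    unfold gfun
    refine ContinuousOn.sub (h.comp_continuousOn (ContinuousOn.div (by fun_prop) (by fun_prop) hne))
      (ContinuousOn.mul (ContinuousOn.div (by fun_prop) (by fun_prop) hne) (by fun_prop))

noncomputable def Jfun (p : ℝ) : ℝ := p*(Real.log (1+p) - Real.log p)^2
      - 2 * Hbin p * (1 - p*(Real.log (1+p) - Real.log p))

lemma J_integrable : IntervalIntegrable Jfun MeasureTheory.volume 0 1 := by
  have h := gfun_integrable
  rw [Set.uIoc_of_le zero_le_one] at h
  unfold MeasureTheory.IntegrableOn at h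
  rw [MeasureTheory.Measure.volume_eq_prod, ← MeasureTheory.Measure.prod_restrict] at h
  have h2 := (h.integral_prod_left).const_mul 2
  rw [intervalIntegrable_iff_integrableOn_Ioc_of_le zero_le_one]
  refine MeasureTheory.Integrable.congr h2 ?_
  refine (MeasureTheory.ae_restrict_iff' measurableSet_Ioc).2 (Filter.Eventually.of_forall ?_)
  intro p hp
  have := gfun_inner hp
  rw [intervalIntegral.integral_of_le zero_le_one] at this
  simp only [Function.uncurry_apply_pair, this, Jfun]
  ring

lemma Flim_integral_eq_J : ∫ p in (0:ℝ)..1, ∫ q in (0:ℝ)..1, Flim p q = ∫ p in (0:ℝ)..1, Jfun p := by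
  have hg := gfun_integrable
  rw [Set.uIoc_of_le zero_le_one] at hg
  unfold MeasureTheory.IntegrableOn at hg
  rw [MeasureTheory.Measure.volume_eq_prod, ← MeasureTheory.Measure.prod_restrict] at hg
  have hsw := MeasureTheory.integral_integral_swap hg
  have hl := hg.integral_prod_left
  have hr := hg.integral_prod_right
  have e1 := hg.prod_right_ae
  have e2 := hg.prod_left_ae
  simp only [Function.uncurry_apply_pair] at hl hr e1 e2
  simp only [intervalIntegral.integral_of_le (zero_le_one (α := ℝ))]
  have key : ∀ᵐ p ∂(MeasureTheory.volume.restrict (Set.Ioc (0:ℝ) 1)),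
      ∫ q in Set.Ioc (0:ℝ) 1, Flim p q = (∫ q in Set.Ioc (0:ℝ) 1, gfun p q)
        + ∫ q in Set.Ioc (0:ℝ) 1, gfun q p := by
    filter_upwards [e1, e2, MeasureTheory.ae_restrict_mem measurableSet_Ioc] with p h1 h2 hp
    rw [← MeasureTheory.integral_add h1 h2]
    exact MeasureTheory.setIntegral_congr_fun measurableSet_Ioc fun q hq => Flim_eq hp.1 hq.1
  rw [MeasureTheory.integral_congr_ae key, MeasureTheory.integral_add hl hr, ← hsw,
    ← MeasureTheory.integral_add hl hl]
  refine MeasureTheory.setIntegral_congr_fun measurableSet_Ioc fun p hp => ?_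
  have := gfun_inner hp
  rw [intervalIntegral.integral_of_le zero_le_one] at this
  simp only [Function.uncurry_apply_pair, this, Jfun]
  ring

noncomputable def Gfun (p : ℝ) : ℝ :=
  (p^2-1)/2 * Real.log (1+p)^2 + (-p-(2/3)*p^2)*(p*Real.log p)*Real.log (1+p)
  + (1/2+(2/3)*p)*(p*Real.log p)^2
  + (1-p)*(2*p+1)/3*((1-p)*Real.log (1-p))*Real.log (1+p)
  + (p-(2/3)*p^2)*(p*Real.log p*Real.log (1-p))
  + (p^2+8*p+7)/6*Real.log (1+p) + (1+2*p)/3*((1-p)*Real.log (1-p))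
  + (p/2-2/3)*(p*Real.log p) - p/6

lemma cont_aab : Continuous fun x : ℝ => x * Real.log x * Real.log (1-x) := by
  rw [continuous_iff_continuousAt]
  intro x
  by_cases hx : x = 1
  · subst hx
    have h1 : ContinuousAt (fun x : ℝ => x * dslope Real.log 1 x * (-((1-x) * Real.log (1-x)))) 1 := by
      refine ContinuousAt.mul (continuousAt_id.mul ?_) ?_
      · exact continuousAt_dslope_same.2 (Real.differentiableAt_log one_ne_zero)
      · exact (Real.continuous_mul_log.comp (continuous_const.sub continuous_id)).neg.continuousAt
    refine h1.congr (Filter.Eventually.of_forall fun x => ?_)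
    have := sub_smul_dslope Real.log 1 x
    simp only [smul_eq_mul, Real.log_one, sub_zero] at this
    simp only
    rw [← this]; ring
  · exact Real.continuous_mul_log.continuousAt.mul
      (ContinuousAt.log (by fun_prop) (sub_ne_zero.2 (Ne.symm hx)))

lemma G_cont : ContinuousOn Gfun (Set.Icc 0 1) := by
  have h1 := Real.continuous_mul_log
  have h2 : Continuous fun x : ℝ => (1-x) * Real.log (1-x) :=
    Real.continuous_mul_log.comp (continuous_const.sub continuous_id)
  have h3 := cont_aab
  have h4 : ContinuousOn (fun x : ℝ => Real.log (1+x)) (Set.Icc 0 1) :=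
    ContinuousOn.log (by fun_prop) fun x hx => by have := hx.1; positivity
  unfold Gfun
  have h1' := h1.continuousOn (s := Set.Icc 0 1)
  have h2' := h2.continuousOn (s := Set.Icc 0 1)
  have h3' := h3.continuousOn (s := Set.Icc 0 1)
  refine ContinuousOn.sub (.add (.add (.add (.add (.add (.add (.add ?_ ?_) ?_) ?_) ?_) ?_) ?_) ?_)
    (by fun_prop)
  · exact .mul (by fun_prop) (h4.pow 2)
  · exact .mul (.mul (by fun_prop) h1') h4
  · exact .mul (by fun_prop) (h1'.pow 2)
  · exact .mul (.mul (by fun_prop) h2') h4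
  · exact .mul (by fun_prop) h3'
  · exact .mul (by fun_prop) h4
  · exact .mul (by fun_prop) h2'
  · exact .mul (by fun_prop) h1'

lemma G_deriv {p : ℝ} (hp : p ∈ Set.Ioo (0:ℝ) 1) : HasDerivAt Gfun
    (Jfun p - (1/3)*(Real.log p/(1-p)) - (1/3)*(Real.log p/(1+p)) - (4/3)*(Real.log (1-p)/(1+p))) p := by
  have hp0 := hp.1.ne'
  have hm : 1 - p ≠ 0 := by linarith [hp.2]
  have hpl : 1 + p ≠ 0 := by linarith [hp.1]
  have i := hasDerivAt_id' p
  have ha : HasDerivAt Real.log p⁻¹ p := Real.hasDerivAt_log hp0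
  have hb : HasDerivAt (fun x => Real.log (1-x)) (-1/(1-p)) p := (i.const_sub 1).log hm
  have hc : HasDerivAt (fun x => Real.log (1+x)) (1/(1+p)) p := (i.const_add 1).log hpl
  have hxa := i.mul ha
  have hxb := (i.const_sub 1).mul hb
  have t1 := (((i.pow 2).sub_const 1).div_const 2).mul (hc.pow 2)
  have t2 := ((i.neg.sub ((i.pow 2).const_mul (2/3))).mul hxa).mul hc
  have t3 := ((i.const_mul (2/3)).const_add (1/2)).mul (hxa.pow 2)
  have t4 := ((((i.const_sub 1).mul ((i.const_mul 2).add_const 1)).div_const 3).mul hxb).mul hc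
  have t5 := (i.sub ((i.pow 2).const_mul (2/3))).mul (hxa.mul hb)
  have t6 := ((((i.pow 2).add (i.const_mul 8)).add_const 7).div_const 6).mul hc
  have t7 := (((i.const_mul 2).const_add 1).div_const 3).mul hxb
  have t8 := ((i.div_const 2).sub_const (2/3)).mul hxa
  have := (((((((t1.add t2).add t3).add t4).add t5).add t6).add t7).add t8).sub (i.div_const 6)
  refine this.congr_deriv ?_
  simp only [Jfun, Hbin, Real.negMulLog, Pi.mul_apply, Pi.pow_apply, Pi.sub_apply, Pi.neg_apply,
    Pi.add_apply]
  generalize Real.log p = a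
  generalize Real.log (1-p) = b
  generalize Real.log (1+p) = c
  push_cast
  field_simp
  ring

lemma J_val : ∫ p in (0:ℝ)..1, Jfun p = (8 / 3) * Real.log 2 + (2 / 3) * (Real.log 2) ^ 2
        - (7 / 36) * Real.pi ^ 2 - 1 / 6 := by
  have i1 := A1_integrable.const_mul (1/3)
  have i2 := A2_integrable.const_mul (1/3)
  have i3 := A3_integrable.const_mul (4/3)
  have h := intervalIntegral.integral_eq_sub_of_hasDerivAt_of_le zero_le_one G_cont
    (fun p hp => G_deriv hp) (((J_integrable.sub i1).sub i2).sub i3)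
  rw [intervalIntegral.integral_sub ((J_integrable.sub i1).sub i2) i3,
    intervalIntegral.integral_sub (J_integrable.sub i1) i2,
    intervalIntegral.integral_sub J_integrable i1,
    intervalIntegral.integral_const_mul, intervalIntegral.integral_const_mul,
    intervalIntegral.integral_const_mul, A1_val, A2_val, A3_val] at h
  have g1 : Gfun 1 = (8/3)*Real.log 2 - 1/6 := by
    unfold Gfun; norm_num
  have g0 : Gfun 0 = 0 := by unfold Gfun; norm_num
  rw [g1, g0] at h
  linarith

open Real Filter in
theorem asymptotic_ePower_UMM :
    Tendsto (fun N : ℕ =>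
        (1 / (N : ℝ)) * ∑ z : Fin N → Bool, QummSingle z * Real.log (UMM z))
      atTop
      (nhds ((8 / 3) * Real.log 2 + (2 / 3) * (Real.log 2) ^ 2
        - (7 / 36) * π ^ 2 - 1 / 6)) ∧
    Tendsto (fun N : ℕ =>
        (1 / (N : ℝ)) * ∑ z : Fin N → Bool, QummSingle z * Real.log (ELB z))
      atTop
      (nhds ((8 / 3) * Real.log 2 + (2 / 3) * (Real.log 2) ^ 2
        - (7 / 36) * π ^ 2 - 1 / 6)) := by
  rw [← J_val, ← Flim_integral_eq_J]
  exact ⟨(tendsto_add_atTop_iff_nat 1).1 UMM_tendsto, (tendsto_add_atTop_iff_nat 1).1 ELB_tendsto⟩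
end

section
/- For every integer N ≥ 2, the number-of-ones statistic fails to be supercomplete with respect to the Bernoulli model: there exists f : {0,…,N} → ℝ with f(1) > 0 such that ∑_{k=0}^N f(k) C(N,k) θ^k (1−θ)^{N−k} ≤ 0 for all θ ∈ (0,1). Concretely, the function f given by f(0) = −1, f(1) = 2/N, f(2) = −2/(N(N−1)), and f(k) = 0 for k ≥ 3 satisfies ∑_{k=0}^N f(k) C(N,k) ρ^k = −(ρ − 1)^2 for every real ρ, and hence ∑_{k=0}^N f(k) C(N,k) θ^k (1−θ)^{N−k} = −(1−θ)^{N−2}(2θ−1)^2 ≤ 0 for all θ ∈ (0,1) while f(1) = 2/N > 0. -/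
open Finset

theorem onesCount_not_supercomplete_for_bernoulli (N : ℕ) (hN : 2 ≤ N) :
    ∃ f : ℕ → ℝ,
      f 1 > 0 ∧
      (∀ θ ∈ Set.Ioo (0:ℝ) 1,
        ∑ k ∈ Finset.range (N + 1),
          f k * (N.choose k : ℝ) * θ ^ k * (1 - θ) ^ (N - k) ≤ 0) ∧
      f = (fun k => if k = 0 then -1 else if k = 1 then 2 / (N : ℝ)
            else if k = 2 then -(2 / ((N : ℝ) * ((N : ℝ) - 1))) else 0) ∧
      (∀ ρ : ℝ, ∑ k ∈ Finset.range (N + 1),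
          f k * (N.choose k : ℝ) * ρ ^ k = -(ρ - 1) ^ 2) ∧
      (∀ θ ∈ Set.Ioo (0:ℝ) 1,
        ∑ k ∈ Finset.range (N + 1),
          f k * (N.choose k : ℝ) * θ ^ k * (1 - θ) ^ (N - k) =
            -((1 - θ) ^ (N - 2) * (2 * θ - 1) ^ 2)) := by
  obtain ⟨m, rfl⟩ : ∃ m, N = m + 2 := ⟨N - 2, by omega⟩
  have key : ∀ g : ℕ → ℝ, ∑ k ∈ Finset.range (m + 2 + 1),
      (fun k : ℕ => if k = 0 then (-1 : ℝ) else if k = 1 then 2 / ((m + 2 : ℕ) : ℝ)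
            else if k = 2 then -(2 / (((m + 2 : ℕ) : ℝ) * (((m + 2 : ℕ) : ℝ) - 1))) else 0) k
        * ((m + 2).choose k : ℝ) * g k = -g 0 + 2 * g 1 - g 2 := by
    intro g
    have h1 : (m : ℝ) + 2 ≠ 0 := by positivity
    have h2 : (m : ℝ) + 2 - 1 ≠ 0 := by
      have : (0 : ℝ) ≤ m := Nat.cast_nonneg m
      linarith
    rw [Finset.sum_range_succ', Finset.sum_range_succ', Finset.sum_range_succ',
      Finset.sum_eq_zero (by intro k _; simp)]
    simp [Nat.cast_choose_two]
    field_simp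
    ring
  have h5 : ∀ θ ∈ Set.Ioo (0:ℝ) 1, ∑ k ∈ Finset.range (m + 2 + 1),
      (fun k : ℕ => if k = 0 then (-1 : ℝ) else if k = 1 then 2 / ((m + 2 : ℕ) : ℝ)
            else if k = 2 then -(2 / (((m + 2 : ℕ) : ℝ) * (((m + 2 : ℕ) : ℝ) - 1))) else 0) k
        * ((m + 2).choose k : ℝ) * θ ^ k * (1 - θ) ^ (m + 2 - k) =
            -((1 - θ) ^ (m + 2 - 2) * (2 * θ - 1) ^ 2) := by
    intro θ _
    have h := key (fun k => θ ^ k * (1 - θ) ^ (m + 2 - k))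
    simp only [← mul_assoc] at h
    refine h.trans ?_
    have e1 : m + 2 - 1 = m + 1 := by omega
    have e2 : m + 2 - 2 = m := by omega
    simp only [e1, e2, Nat.sub_zero]
    ring
  refine ⟨_, ?_, ?_, rfl, ?_, h5⟩
  · simp
    positivity
  · intro θ hθ
    rw [h5 θ hθ]
    have : 0 < 1 - θ := by linarith [hθ.2]
    have : 0 ≤ (1 - θ) ^ (m + 2 - 2) * (2 * θ - 1) ^ 2 := by positivity
    linarith
  · intro ρ
    refine (key (fun k => ρ ^ k)).trans ?_
    ring
end
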